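/- arXiv:1706.08447 — 4 statements merged into one kernel-verified Lean document; each statement's English description precedes it below -/
import Mathlib

section
/- Let q be a power of an odd prime and let f = X^q + X^2 ∈ F_q[X]. Then the Galois group of f(X) - t over the rational function field F_q(t) has cardinality q!, i.e. the arithmetic monodromy group A_f of f is the full symmetric group S_q. -/
open Polynomial

theorem aux_diff {S : Type*} [CommRing S] [IsDomain S] (p a : ℕ) [Fact p.Prime] [CharP S p]
    {x y : S} (h : x ^ p ^ a + x ^ 2 = y ^ p ^ a + y ^ 2) (hxy : x ≠ y) :
    (y - x) ^ (p ^ a - 1) + (y - x) + 2 * x = 0 := by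
  have h1 : (y - x) ^ p ^ a = y ^ p ^ a - x ^ p ^ a := sub_pow_char_pow y x a
  have hq : 1 ≤ p ^ a := Nat.one_le_pow _ _ (Fact.out : p.Prime).pos
  have h2 : (y - x) ^ p ^ a = (y - x) * (y - x) ^ (p ^ a - 1) := by
    rw [← pow_succ', Nat.sub_add_cancel hq]
  have h3 : (y - x) * ((y - x) ^ (p ^ a - 1) + (y - x) + 2 * x) = 0 := by
    rw [mul_add, mul_add, ← h2, h1]; linear_combination -h
  exact (mul_eq_zero.1 h3).resolve_left (sub_ne_zero.2 hxy.symm)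

theorem aux_monic {S : Type*} [CommRing S] [Nontrivial S] (q : ℕ) (hq : 3 ≤ q) (c : S) :
    (X ^ q + X ^ 2 - C c : S[X]).Monic ∧ (X ^ q + X ^ 2 - C c : S[X]).natDegree = q := by
  have hd : (X ^ 2 - C c : S[X]).degree < q := by
    rw [degree_X_pow_sub_C (by norm_num)]
    exact_mod_cast hq
  rw [add_sub_assoc]
  refine ⟨monic_X_pow_add hd, ?_⟩
  apply natDegree_eq_of_degree_eq_some
  rw [degree_add_eq_left_of_degree_lt, degree_X_pow]
  rwa [degree_X_pow]

theorem aux_irred (F : Type) [Field F] (P : F[X]) (hP : P.natDegree ≠ 0) :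
    Irreducible (P.map (algebraMap F (RatFunc F)) - C RatFunc.X) := by
  have hirr : Irreducible (P.map C - C X : F[X][X]) := by
    have h : Irreducible (C P - X : F[X][X]) := by
      have e : Associated (X - C P : F[X][X]) (C P - X) := ⟨-1, by simp⟩
      exact e.irreducible (Polynomial.irreducible_X_sub_C P)
    rw [← MulEquiv.irreducible_iff (Polynomial.Bivariate.swap (R := F))] at h
    convert h using 1
    simp [Polynomial.Bivariate.swap_C, Polynomial.Bivariate.swap_Y]
  have hdeg : (P.map C - C X : F[X][X]).natDegree ≠ 0 := by
    rw [natDegree_sub_C, natDegree_map_eq_of_injective C_injective]; exact hP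
  have := (IsPrimitive.irreducible_iff_irreducible_map_fraction_map (K := RatFunc F)
    (hirr.isPrimitive hdeg)).1 hirr
  convert this using 1
  rw [Polynomial.map_sub, Polynomial.map_map, map_C]
  congr 2

theorem aux_two_trans (p a : ℕ) [Fact p.Prime] (hodd : Odd p) (ha : 0 < a)
    (F : Type) [Field F] [CharP F p] (L : Type) [Field L] [Algebra (RatFunc F) L]
    [Normal (RatFunc F) L] {x y x' y' : L}
    (hx : x ^ p ^ a + x ^ 2 = algebraMap (RatFunc F) L RatFunc.X)
    (hy : y ^ p ^ a + y ^ 2 = algebraMap (RatFunc F) L RatFunc.X)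
    (hx' : x' ^ p ^ a + x' ^ 2 = algebraMap (RatFunc F) L RatFunc.X)
    (hy' : y' ^ p ^ a + y' ^ 2 = algebraMap (RatFunc F) L RatFunc.X)
    (hxy : x ≠ y) (hxy' : x' ≠ y') : ∃ g : L ≃ₐ[RatFunc F] L, g x = x' ∧ g y = y' := by
  have hp2 : p ≠ 2 := by rintro rfl; exact absurd hodd (by decide)
  have hp3 : 3 ≤ p := by have := (Fact.out : p.Prime).two_le; omega
  have hq : 3 ≤ p ^ a := hp3.trans (Nat.le_self_pow ha.ne' p)
  have : CharP (RatFunc F) p := charP_of_injective_algebraMap (algebraMap F (RatFunc F)).injective p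
  have : CharP L p := charP_of_injective_algebraMap (algebraMap (RatFunc F) L).injective p
  have h2F : (2 : F) ≠ 0 := Ring.two_ne_zero (by rwa [ringChar.eq_iff.2 ‹CharP F p›])
  have h2e : ((algebraMap (RatFunc F) L).comp (algebraMap F (RatFunc F))) 2 = 2 := map_ofNat _ 2
  have h2L : (2 : L) ≠ 0 := by
    rw [← h2e]; exact (_root_.map_ne_zero _).2 h2F
  let W : F[X] := C (-(2:F)⁻¹) * (X ^ (p ^ a - 1) + X)
  let P : F[X] := (X ^ p ^ a + X ^ 2 : F[X]).comp W
  have hW : W.natDegree = p ^ a - 1 := by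
    rw [natDegree_C_mul (by simpa using h2F)]
    compute_degree!
    · rw [if_neg (by omega)]; simp
    · omega
  have hQ : (X ^ p ^ a + X ^ 2 : F[X]).natDegree = p ^ a := by
    compute_degree!
    · rw [if_neg (by omega)]; simp
    all_goals omega
  have hP : P.natDegree ≠ 0 := by
    rw [natDegree_comp, hW, hQ]
    exact mul_ne_zero (by omega) (by omega)
  have hI := aux_irred F P hP
  have key : ∀ {u v : L}, u ^ p ^ a + u ^ 2 = algebraMap (RatFunc F) L RatFunc.X →
     v ^ p ^ a + v ^ 2 = algebraMap (RatFunc F) L RatFunc.X → u ≠ v → 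
     u = -2⁻¹ * ((v - u) ^ (p ^ a - 1) + (v - u)) ∧ 
     aeval (v - u) (P.map (algebraMap F (RatFunc F)) - C RatFunc.X) = 0 := by
    intro u v hu hv huv
    have h := aux_diff p a (hu.trans hv.symm) huv
    have h1 : u = -2⁻¹ * ((v - u) ^ (p ^ a - 1) + (v - u)) := by
      field_simp
      linear_combination h
    refine ⟨h1, ?_⟩
    have h3 : eval₂ ((algebraMap (RatFunc F) L).comp (algebraMap F (RatFunc F))) (v - u) W = u := by
      conv_rhs => rw [h1]
      simp only [W, eval₂_mul, eval₂_C, eval₂_add, eval₂_pow, eval₂_X]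
      rw [map_neg, map_inv₀, h2e]
    rw [map_sub, aeval_C, sub_eq_zero, ← hu, aeval_def, eval₂_map]
    simp only [P, eval₂_comp, h3]
    simp
  obtain ⟨e1, r1⟩ := key hx hy hxy
  obtain ⟨e2, r2⟩ := key hx' hy' hxy'
  have m1 := minpoly.eq_of_irreducible hI r1
  have m2 := minpoly.eq_of_irreducible hI r2
  obtain ⟨g, hg⟩ := (isConjRoot_iff_exists_algEquiv (K := RatFunc F) (x := y' - x') (y := y - x)).1
    (m2.symm.trans m1)
  have hgx : g x = x' := by
    rw [e1, e2]
    simp only [map_mul, map_add, map_pow, map_neg, map_inv₀, hg, map_ofNat]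
  refine ⟨g, hgx, ?_⟩
  rw [map_sub, hgx] at hg
  exact sub_left_injective hg


theorem aux_inertia (F : Type) [Field F] [Fintype F] (L : Type) [Field L] [Algebra (RatFunc F) L]
    [Algebra F[X] L] [IsScalarTower F[X] (RatFunc F) L] [FiniteDimensional (RatFunc F) L]
    [IsGalois (RatFunc F) L] (Q : Ideal (integralClosure F[X] L)) [Q.IsPrime]
    (hQ : Q.LiesOver (Ideal.span {(X : F[X])}))
    (ht : algebraMap F[X] (integralClosure F[X] L) X ∈ Q ^ 2) :
    ∃ g : L ≃ₐ[RatFunc F] L, g ≠ 1 ∧ g ∈ Q.inertia (L ≃ₐ[RatFunc F] L) := by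
  have : IsFractionRing (integralClosure F[X] L) L := integralClosure.isFractionRing_of_finite_extension (RatFunc F) L
  have : IsDedekindDomain (integralClosure F[X] L) := integralClosure.isDedekindDomain F[X] (RatFunc F) L
  have : Module.Finite F[X] (integralClosure F[X] L) := IsIntegralClosure.finite F[X] (RatFunc F) L (integralClosure F[X] L)
  have : FaithfulSMul F[X] L := by
    rw [faithfulSMul_iff_algebraMap_injective, IsScalarTower.algebraMap_eq F[X] (RatFunc F) L]
    exact (algebraMap (RatFunc F) L).injective.comp (IsFractionRing.injective F[X] (RatFunc F))
  have : FaithfulSMul F[X] (integralClosure F[X] L) := inferInstance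
  have : Module.Flat F[X] (integralClosure F[X] L) := inferInstance
  have : IsGaloisGroup (L ≃ₐ[RatFunc F] L) F[X] (integralClosure F[X] L) :=
    IsGaloisGroup.of_isFractionRing _ F[X] (integralClosure F[X] L) (RatFunc F) L
  generalize hI : Ideal.span {(X : F[X])} = I at hQ
  have : I.IsMaximal := by
    rw [← hI]
    exact PrincipalIdealRing.isMaximal_of_irreducible irreducible_X
  have : PerfectField I.ResidueField := by
    have : Finite (F[X] ⧸ I) := by
      have e := (Polynomial.quotientSpanXSubCAlgEquiv (0 : F)).toEquiv
      rw [C_0, sub_zero, hI] at e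
      exact Finite.of_equiv F e.symm
    infer_instance
  have h1 := Ideal.card_inertia_eq_ramificationIdxIn (G := (L ≃ₐ[RatFunc F] L)) I Q
  rw [Ideal.ramificationIdxIn_eq_ramificationIdx I Q (L ≃ₐ[RatFunc F] L)] at h1
  have hne : I.map (algebraMap F[X] (integralClosure F[X] L)) ≠ ⊥ := by
    rw [Ne, Ideal.map_eq_bot_iff_of_injective (FaithfulSMul.algebraMap_injective _ _)]
    simp [← hI]
  rw [Ideal.IsDedekindDomain.ramificationIdx_eq_multiplicity I Q hne] at h1
  have h2 : 2 ≤ multiplicity Q (I.map (algebraMap F[X] (integralClosure F[X] L))) := by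
    have hle : I.map (algebraMap F[X] (integralClosure F[X] L)) ≤ Q ^ 2 := by
      rw [← hI, Ideal.map_span, Set.image_singleton, Ideal.span_singleton_le_iff_mem]
      exact ht
    refine FiniteMultiplicity.le_multiplicity_of_pow_dvd ?_ (Ideal.dvd_iff_le.2 hle)
    refine FiniteMultiplicity.of_not_isUnit ?_ hne
    rw [Ideal.isUnit_iff]
    exact Ideal.IsPrime.ne_top ‹_›
  rw [← h1] at h2
  have : Nontrivial (Q.inertia (L ≃ₐ[RatFunc F] L)) := by
    exact (Finite.one_lt_card_iff_nontrivial).1 h2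
  obtain ⟨g, hg⟩ := exists_ne (1 : Q.inertia (L ≃ₐ[RatFunc F] L))
  exact ⟨g, by simpa using hg, g.2⟩

theorem aux_transp (p a : ℕ) [Fact p.Prime] (hodd : Odd p) (ha : 0 < a)
    (F : Type) [Field F] [Fintype F] [CharP F p]
    (L : Type) [Field L] [Algebra (RatFunc F) L]
    [Algebra F[X] L] [IsScalarTower F[X] (RatFunc F) L] [FiniteDimensional (RatFunc F) L]
    [IsGalois (RatFunc F) L]
    (hs : (X ^ p ^ a + X ^ 2 - C (algebraMap F[X] L X) : L[X]).Splits)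
    (hgen : ∀ g : L ≃ₐ[RatFunc F] L, (∀ x, x ^ p ^ a + x ^ 2 = algebraMap F[X] L X → g x = x) →
      g = 1) :
    ∃ (g : L ≃ₐ[RatFunc F] L) (x y : L), x ≠ y ∧ x ^ p ^ a + x ^ 2 = algebraMap F[X] L X ∧
      y ^ p ^ a + y ^ 2 = algebraMap F[X] L X ∧ g x = y ∧ g y = x ∧
      ∀ z, z ^ p ^ a + z ^ 2 = algebraMap F[X] L X → z ≠ x → z ≠ y → g z = z := by
  have hp2 : p ≠ 2 := by rintro rfl; exact absurd hodd (by decide)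
  have hp3 : 3 ≤ p := by have := (Fact.out : p.Prime).two_le; omega
  have hq : 3 ≤ p ^ a := hp3.trans (Nat.le_self_pow ha.ne' p)
  have : FaithfulSMul F[X] L := by
    rw [faithfulSMul_iff_algebraMap_injective, IsScalarTower.algebraMap_eq F[X] (RatFunc F) L]
    exact (algebraMap (RatFunc F) L).injective.comp (IsFractionRing.injective F[X] (RatFunc F))
  have : CharP F[X] p := inferInstance
  have : CharP (integralClosure F[X] L) p :=
    charP_of_injective_algebraMap (FaithfulSMul.algebraMap_injective F[X] (integralClosure F[X] L)) p
  have h2F : (2 : F) ≠ 0 := Ring.two_ne_zero (by rwa [ringChar.eq_iff.2 ‹CharP F p›])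
  have : (Ideal.span {(X : F[X])}).IsMaximal :=
    PrincipalIdealRing.isMaximal_of_irreducible irreducible_X
  obtain ⟨Q, hQm, hQ⟩ := Ideal.exists_maximal_ideal_liesOver_of_isIntegral
    (S := integralClosure F[X] L) (Ideal.span {(X : F[X])})
  have hTQ : algebraMap F[X] (integralClosure F[X] L) X ∈ Q := by
    rw [← Ideal.mem_of_liesOver Q (Ideal.span {(X : F[X])})]
    exact Ideal.mem_span_singleton_self _
  have h2Q : (2 : integralClosure F[X] L) ∉ Q := by
    have hu : IsUnit (2 : integralClosure F[X] L) := by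
      have := ((isUnit_iff_ne_zero.2 h2F).map (C : F →+* F[X])).map
        (algebraMap F[X] (integralClosure F[X] L))
      simpa only [map_ofNat] using this
    intro h
    exact hQm.ne_top (Ideal.eq_top_of_isUnit_mem _ h hu)
  have hint : ∀ x : L, x ^ p ^ a + x ^ 2 = algebraMap F[X] L X → x ∈ integralClosure F[X] L := by
    intro x hx
    refine ⟨X ^ p ^ a + X ^ 2 - C X, ?_, ?_⟩
    · exact (aux_monic _ hq X).1
    · simp [hx]
  have hlift : ∀ x : L, ∀ hx : x ^ p ^ a + x ^ 2 = algebraMap F[X] L X,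
      (⟨x, hint x hx⟩ : integralClosure F[X] L) ^ p ^ a + ⟨x, hint x hx⟩ ^ 2 = 
        algebraMap F[X] (integralClosure F[X] L) X := by
    intro x hx
    exact Subtype.ext hx
  -- a root in `Q`
  obtain ⟨s, hsQ, hsr⟩ : ∃ s ∈ Q, s ^ p ^ a + s ^ 2 =
      algebraMap F[X] (integralClosure F[X] L) X := by
    set f : L[X] := X ^ p ^ a + X ^ 2 - C (algebraMap F[X] L X) with hf
    have hm : f.Monic := by
      exact (aux_monic _ hq _).1
    have hroot : ∀ x ∈ f.roots, x ^ p ^ a + x ^ 2 = algebraMap F[X] L X := by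
      intro x hx
      have := (mem_roots'.1 hx).2
      simpa [hf, sub_eq_zero] using this
    have hprod := hs.coeff_zero_eq_prod_roots_of_monic hm
    have hc : f.coeff 0 = - algebraMap F[X] L X := by
      rw [coeff_zero_eq_eval_zero, hf]
      have h0 : p ^ a ≠ 0 := by omega
      simp [-pow_eq_zero_iff, zero_pow h0]
    obtain ⟨M, hM⟩ : ∃ M : Multiset (integralClosure F[X] L), M.map (algebraMap _ L) = f.roots := by
      refine ⟨f.roots.attach.map fun x => ⟨x.1, hint _ (hroot _ x.2)⟩, ?_⟩
      rw [Multiset.map_map]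
      exact Multiset.attach_map_val _
    have hMQ : M.prod ∈ Q := by
      have e : algebraMap (integralClosure F[X] L) L M.prod = f.roots.prod := by
        rw [map_multiset_prod, hM]
      have e2 : M.prod = (-1) ^ f.natDegree * (- algebraMap F[X] (integralClosure F[X] L) X) := by
        apply FaithfulSMul.algebraMap_injective (integralClosure F[X] L) L
        rw [e, map_mul, map_pow, map_neg, map_neg, map_one, ← IsScalarTower.algebraMap_apply, ← hc,
          hprod, ← mul_assoc, ← mul_pow]
        simp
      rw [e2]
      exact Q.mul_mem_left _ (Q.neg_mem hTQ)
    obtain ⟨s, hsM, hsQ⟩ := (Ideal.IsPrime.multiset_prod_mem_iff_exists_mem hQm.isPrime M).1 hMQ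
    refine ⟨s, hsQ, Subtype.ext ?_⟩
    have := hroot (algebraMap _ L s) (by rw [← hM]; exact Multiset.mem_map_of_mem _ hsM)
    exact this
  have htQ : algebraMap F[X] (integralClosure F[X] L) X ∈ Q ^ 2 := by
    rw [← hsr]
    exact Ideal.add_mem _ (Ideal.pow_le_pow_right (by omega) (Ideal.pow_mem_pow hsQ _))
      (Ideal.pow_mem_pow hsQ _)
  obtain ⟨g, hg1, hgI⟩ := aux_inertia F L Q hQ htQ
  have hpowQ : ∀ (d : integralClosure F[X] L), d ∈ Q → d ^ (p ^ a - 1) ∈ Q :=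
    fun d hd => Q.pow_mem_of_mem hd _ (by omega)
  -- congruent distinct roots lie in `Q`
  have hcong : ∀ u v : integralClosure F[X] L,
      u ^ p ^ a + u ^ 2 = algebraMap F[X] (integralClosure F[X] L) X →
      v ^ p ^ a + v ^ 2 = algebraMap F[X] (integralClosure F[X] L) X → u ≠ v → v - u ∈ Q →
      u ∈ Q := by
    intro u v hu hv huv hd
    have h := aux_diff p a (hu.trans hv.symm) huv
    have h2 : 2 * u ∈ Q := by
      have : 2 * u = -((v - u) ^ (p ^ a - 1) + (v - u)) := by linear_combination h
      rw [this]
      exact Q.neg_mem (Q.add_mem (hpowQ _ hd) hd)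
    exact (hQm.isPrime.mem_or_mem h2).resolve_left h2Q
  have hthree : ∀ u v w : integralClosure F[X] L,
      u ^ p ^ a + u ^ 2 = algebraMap F[X] (integralClosure F[X] L) X →
      v ^ p ^ a + v ^ 2 = algebraMap F[X] (integralClosure F[X] L) X →
      w ^ p ^ a + w ^ 2 = algebraMap F[X] (integralClosure F[X] L) X →
      u ∈ Q → v ∈ Q → w ∈ Q → u ≠ v → u ≠ w → v = w := by
    intro u v w hu hv hw huQ hvQ hwQ huv huw
    by_contra hvw
    have h1 := aux_diff p a (hu.trans hv.symm) huv
    have h2 := aux_diff p a (hu.trans hw.symm) huw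
    have hd1 := Q.sub_mem hvQ huQ
    have hd2 := Q.sub_mem hwQ huQ
    generalize hd : v - u = d at *
    generalize he : w - u = e at *
    have hde : d - e ≠ 0 := by
      rw [← hd, ← he]; intro h; apply hvw; linear_combination h
    have h3 := geom_sum₂_mul d e (p ^ a - 1)
    have h4 : (∑ i ∈ Finset.range (p ^ a - 1), d ^ i * e ^ (p ^ a - 1 - 1 - i)) = -1 := by
      apply mul_right_cancel₀ hde
      rw [h3]; linear_combination h1 - h2
    have h5 : (∑ i ∈ Finset.range (p ^ a - 1), d ^ i * e ^ (p ^ a - 1 - 1 - i)) ∈ Q := by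
      refine Q.sum_mem fun i hi => ?_
      by_cases h0 : i = 0
      · subst h0
        exact Q.mul_mem_left _ (Q.pow_mem_of_mem hd2 _ (by omega))
      · exact Q.mul_mem_right _ (Q.pow_mem_of_mem hd1 _ (by omega))
    rw [h4] at h5
    exact hQm.ne_top ((Ideal.eq_top_iff_one _).2 (by simpa using Q.neg_mem h5))
  have hgroot : ∀ x : L, x ^ p ^ a + x ^ 2 = algebraMap F[X] L X →
      (g x) ^ p ^ a + (g x) ^ 2 = algebraMap F[X] L X := by
    intro x hx
    rw [← map_pow, ← map_pow, ← map_add, hx, IsScalarTower.algebraMap_apply F[X] (RatFunc F) L,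
      g.commutes]
  have hmove : ∀ (x : L) (hx : x ^ p ^ a + x ^ 2 = algebraMap F[X] L X), g x ≠ x →
      (⟨x, hint x hx⟩ : integralClosure F[X] L) ∈ Q ∧ 
      (⟨g x, hint _ (hgroot x hx)⟩ : integralClosure F[X] L) ∈ Q := by
    intro x hx hne
    have h1 : (⟨g x, hint _ (hgroot x hx)⟩ : integralClosure F[X] L) - ⟨x, hint x hx⟩ ∈ Q :=
      hgI ⟨x, hint x hx⟩
    have h2 := hcong _ _ (hlift x hx) (hlift _ (hgroot x hx))
      (fun h => hne (congrArg Subtype.val h).symm) h1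
    exact ⟨h2, by simpa using Q.add_mem h1 h2⟩
  have hex : ∃ x : L, x ^ p ^ a + x ^ 2 = algebraMap F[X] L X ∧ g x ≠ x := by
    by_contra! h
    exact hg1 (hgen g h)
  obtain ⟨x, hx, hne⟩ := hex
  obtain ⟨hxQ, hgxQ⟩ := hmove x hx hne
  have hggne : g (g x) ≠ g x := fun h => hne (g.injective h)
  obtain ⟨-, hggQ⟩ := hmove (g x) (hgroot x hx) hggne
  refine ⟨g, x, g x, hne.symm, hx, hgroot x hx, rfl, ?_, ?_⟩
  · have := hthree _ _ _ (hlift _ (hgroot x hx)) (hlift x hx) (hlift _ (hgroot _ (hgroot x hx)))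
      hgxQ hxQ hggQ (fun h => hne (congrArg Subtype.val h))
      (fun h => hggne (congrArg Subtype.val h).symm)
    exact (congrArg Subtype.val this).symm
  · intro z hz hzx hzg
    by_contra hgz
    have hzQ := (hmove z hz hgz).1
    have := hthree _ _ _ (hlift _ hx) (hlift _ (hgroot x hx)) (hlift z hz)
      hxQ hgxQ hzQ (fun h => hne (congrArg Subtype.val h).symm)
      (fun h => hzx (congrArg Subtype.val h).symm)
    exact hzg (congrArg Subtype.val this).symm

theorem aux_main (p a : ℕ) [Fact p.Prime] (hodd : Odd p) (ha : 0 < a)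
    (F : Type) [Field F] [Fintype F] [CharP F p]
    (L : Type) [Field L] [Algebra (RatFunc F) L]
    [Algebra F[X] L] [IsScalarTower F[X] (RatFunc F) L]
    [hL : IsSplittingField (RatFunc F) L
      ((X : Polynomial (RatFunc F)) ^ p ^ a + X ^ 2 - C RatFunc.X)] :
    Nat.card (L ≃ₐ[RatFunc F] L) = Nat.factorial (p ^ a) := by
  classical
  have hp2 : p ≠ 2 := by rintro rfl; exact absurd hodd (by decide)
  have hp3 : 3 ≤ p := by have := (Fact.out : p.Prime).two_le; omega
  have hq : 3 ≤ p ^ a := hp3.trans (Nat.le_self_pow ha.ne' p)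
  have h2F : (2 : F) ≠ 0 := Ring.two_ne_zero (by rwa [ringChar.eq_iff.2 ‹CharP F p›])
  have : CharP (RatFunc F) p := charP_of_injective_algebraMap (algebraMap F (RatFunc F)).injective p
  have h2K : (2 : RatFunc F) ≠ 0 :=
    Ring.two_ne_zero (by rwa [ringChar.eq_iff.2 ‹CharP (RatFunc F) p›])
  obtain ⟨hmonic, hdeg⟩ := aux_monic (p ^ a) hq (RatFunc.X : RatFunc F)
  generalize hf : ((X : Polynomial (RatFunc F)) ^ p ^ a + X ^ 2 - C RatFunc.X) = f at *
  have hXX : algebraMap (RatFunc F) L RatFunc.X = algebraMap F[X] L X := by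
    rw [IsScalarTower.algebraMap_apply F[X] (RatFunc F) L, RatFunc.algebraMap_X]
  have hder : derivative f = C 2 * X := by
    have : ((p ^ a : ℕ) : RatFunc F) = 0 := by
      rw [CharP.cast_eq_zero_iff (RatFunc F) p]; exact dvd_pow_self p ha.ne'
    rw [← hf, derivative_sub, derivative_add, derivative_X_pow, derivative_X_pow, derivative_C, this]
    simp
  have hsep : f.Separable := by
    rw [Polynomial.separable_def, hder]
    have hX : IsCoprime f X := by
      have hc : IsCoprime (-C (RatFunc.X : RatFunc F)) X := by
        refine ⟨-C (RatFunc.X⁻¹), 0, ?_⟩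
        rw [neg_mul_neg, ← C_mul, inv_mul_cancel₀ RatFunc.X_ne_zero]
        simp
      have e : f = -C (RatFunc.X : RatFunc F) + X * (X ^ (p ^ a - 1) + X) := by
        rw [← hf, mul_add, ← pow_succ', Nat.sub_add_cancel (by omega)]
        ring
      rw [e]
      exact hc.add_mul_left_left _
    exact IsCoprime.mul_right ⟨0, C (2⁻¹), by rw [← C_mul, inv_mul_cancel₀ h2K]; simp⟩ hX
  have hgal : IsGalois (RatFunc F) L := IsGalois.of_separable_splitting_field hsep
  have hfd : FiniteDimensional (RatFunc F) L := IsSplittingField.finiteDimensional L f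
  have hmem : ∀ x : L, x ∈ f.rootSet L ↔ x ^ p ^ a + x ^ 2 = algebraMap F[X] L X := by
    intro x
    rw [mem_rootSet_of_ne hmonic.ne_zero, ← hf]
    simp [sub_eq_zero, hXX]
  have hmap : f.map (algebraMap (RatFunc F) L) = X ^ p ^ a + X ^ 2 - C (algebraMap F[X] L X) := by
    rw [← hf, ← hXX]; simp
  have hgen : ∀ g : L ≃ₐ[RatFunc F] L,
      (∀ x, x ^ p ^ a + x ^ 2 = algebraMap F[X] L X → g x = x) → g = 1 := by
    intro g h
    have h1 : (g : L →ₐ[RatFunc F] L) = AlgHom.id (RatFunc F) L := by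
      apply AlgHom.ext_of_adjoin_eq_top hL.adjoin_rootSet
      intro x hx
      exact h x ((hmem x).1 hx)
    ext x
    exact DFunLike.congr_fun h1 x
  have hcard : Nat.card (f.rootSet L) = p ^ a := by
    rw [Nat.card_eq_fintype_card, card_rootSet_eq_natDegree hsep hL.splits, hdeg]
  let φ : (L ≃ₐ[RatFunc F] L) →* Equiv.Perm (f.rootSet L) := MulAction.toPermHom _ _
  have hφ : ∀ g x, ((φ g x : f.rootSet L) : L) = g x := fun g x => rfl
  have hinj : Function.Injective φ := by
    rw [injective_iff_map_eq_one]
    intro g hg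
    apply hgen
    intro x hx
    have := hφ g ⟨x, (hmem x).2 hx⟩
    rw [hg] at this
    exact this.symm
  have hsurj : Function.Surjective φ := by
    rw [← MonoidHom.range_eq_top, eq_top_iff, ← Equiv.Perm.closure_isSwap, Subgroup.closure_le]
    rintro σ ⟨x, y, hxy, rfl⟩
    obtain ⟨g, u, v, huv, hu, hv, hgu, hgv, hgz⟩ := aux_transp p a hodd ha F L
      (by rw [← hmap]; exact hL.splits) hgen
    have hxr := (hmem x).1 x.2
    have hyr := (hmem y).1 y.2
    have hg : φ g = Equiv.swap ⟨u, (hmem u).2 hu⟩ ⟨v, (hmem v).2 hv⟩ := by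
      ext z
      rw [hφ, Equiv.swap_apply_def]
      split_ifs with h1 h2
      · rw [h1]; exact hgu
      · rw [h2]; exact hgv
      · exact hgz z ((hmem z).1 z.2) (fun h => h1 (Subtype.ext h)) (fun h => h2 (Subtype.ext h))
    obtain ⟨k, hk1, hk2⟩ := aux_two_trans p a hodd ha F L (hu.trans hXX.symm) (hv.trans hXX.symm)
      (hxr.trans hXX.symm) (hyr.trans hXX.symm) huv (fun h => hxy (Subtype.ext h))
    refine ⟨k * g * k⁻¹, ?_⟩
    rw [map_mul, map_mul, map_inv, hg]
    have := Equiv.swap_apply_apply (φ k) ⟨u, (hmem u).2 hu⟩ ⟨v, (hmem v).2 hv⟩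
    rw [← this]
    congr 1
    · exact Subtype.ext hk1
    · exact Subtype.ext hk2
  rw [Nat.card_congr (Equiv.ofBijective φ ⟨hinj, hsurj⟩), Nat.card_perm, hcard]

theorem aux_main' (p a : ℕ) [Fact p.Prime] (hodd : Odd p) (ha : 0 < a)
    (F : Type) [Field F] [Fintype F] [CharP F p]
    (L : Type) [Field L] [Algebra (RatFunc F) L]
    [hL : IsSplittingField (RatFunc F) L
      ((X : Polynomial (RatFunc F)) ^ p ^ a + X ^ 2 - C RatFunc.X)] :
    Nat.card (L ≃ₐ[RatFunc F] L) = Nat.factorial (p ^ a) := by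
  letI : Algebra F[X] L := ((algebraMap (RatFunc F) L).comp (algebraMap F[X] (RatFunc F))).toAlgebra
  have : IsScalarTower F[X] (RatFunc F) L := IsScalarTower.of_algebraMap_eq' rfl
  exact aux_main p a hodd ha F L

/-- **Proposition 4.2 (arithmetic part).** Let `q` be a power of an odd prime and
`f = X^q + X^2 ∈ F_q[X]`. The Galois group of `f - t` over `F_q(t)` (the arithmetic
monodromy group of `f`) is the full symmetric group `S_q`, i.e. it has cardinality `q!`. -/
theorem stmt_5 (p a : ℕ) [Fact p.Prime] (hodd : Odd p) (ha : 0 < a)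
    (F : Type) [Field F] [Fintype F] (hF : Fintype.card F = p ^ a) :
    Nat.card ((X : Polynomial (RatFunc F)) ^ p ^ a + X ^ 2 - C RatFunc.X).Gal
      = Nat.factorial (p ^ a) := by
  have : CharP F p := charP_of_card_eq_prime_pow hF
  exact aux_main' p a hodd ha F (SplittingField _)
end

section
/- Let q be a power of an odd prime and let f = X^q + X^2 ∈ F_q[X]. Let 𝔽̄_q be an algebraic closure of F_q. Then the Galois group of f(X) - t over the rational function field 𝔽̄_q(t) has cardinality q!, i.e. the geometric monodromy group G_f of f is the full symmetric group S_q. -/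
open Polynomial

theorem natDegree_aux {R : Type*} [CommRing R] [Nontrivial R] {n : ℕ} (hn : 3 ≤ n) (t : R) :
    (X ^ n + X ^ 2 - C t).natDegree = n := by
  have h1 : n ≠ 2 := by omega
  have h2 : n ≠ 0 := by omega
  apply natDegree_eq_of_le_of_coeff_ne_zero
  · compute_degree
    omega
  · simp [coeff_X_pow, coeff_C, h1, h2]

theorem monic_aux {R : Type*} [CommRing R] {n : ℕ} (hn : 3 ≤ n) (t : R) :
    (X ^ n + X ^ 2 - C t).Monic := by
  nontriviality R
  rw [Monic, leadingCoeff, natDegree_aux hn]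
  have h1 : n ≠ 2 := by omega
  have h2 : n ≠ 0 := by omega
  simp [coeff_X_pow, coeff_C, h1, h2]

theorem isAlgebraic_aeval_aux {K L : Type*} [Field K] [Field L] [Algebra K L] {u : L}
    (h : IsAlgebraic K u) (T : K[X]) : IsAlgebraic K (aeval u T) := by
  have := h.isIntegral
  exact (IsIntegral.of_mem_of_fg (Algebra.adjoin K {u}) this.fg_adjoin_singleton _
    (aeval_mem_adjoin_singleton K u)).isAlgebraic

section
variable {K k L : Type*} [Field K] [Field k] [Field L] [Algebra K[X] k] [IsFractionRing K[X] k]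
  [Algebra k L] [Algebra K[X] L] [IsScalarTower K[X] k L]

theorem perfect_aux [PerfectField K] (I : Ideal K[X]) (hI : I = Ideal.span {X}) [I.IsMaximal] :
    PerfectField I.ResidueField := by
  have hs : Function.Surjective ((algebraMap K[X] I.ResidueField).comp C) := by
    intro y
    obtain ⟨f, rfl⟩ := I.algebraMap_residueField_surjective y
    refine ⟨f.coeff 0, ?_⟩
    rw [RingHom.comp_apply, ← sub_eq_zero, ← map_sub, ← RingHom.mem_ker,
      Ideal.ker_algebraMap_residueField, hI, Ideal.mem_span_singleton, X_dvd_iff]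
    simp
  exact PerfectField.of_ringEquiv (RingEquiv.ofBijective _ ⟨RingHom.injective _, hs⟩)

theorem inertia_aux [PerfectField K] [FiniteDimensional k L] [IsGalois k L]
    (P : Ideal (integralClosure K[X] L)) [P.IsPrime]
    (hP : algebraMap K[X] (integralClosure K[X] L) X ∈ P ^ 2) :
    ∃ σ : Gal(L/k), σ ≠ 1 ∧ ∀ x y : integralClosure K[X] L, σ x = y → y - x ∈ P := by
  let S := integralClosure K[X] L
  have : IsDedekindDomain S := IsIntegralClosure.isDedekindDomain K[X] k L S
  have : Module.Finite K[X] S := IsIntegralClosure.finite K[X] k L S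
  have : IsFractionRing S L := IsIntegralClosure.isFractionRing_of_finite_extension K[X] k L S
  let : MulSemiringAction Gal(L/k) S := IsIntegralClosure.MulSemiringAction K[X] k L S
  have : IsGaloisGroup Gal(L/k) K[X] S := IsGaloisGroup.of_isFractionRing _ _ _ k L
  have hinj : Function.Injective (algebraMap K[X] S) := by
    apply Function.Injective.of_comp (f := algebraMap S L)
    rw [← RingHom.coe_comp, ← IsScalarTower.algebraMap_eq, IsScalarTower.algebraMap_eq K[X] k L]
    exact (algebraMap k L).injective.comp (IsFractionRing.injective K[X] k)
  have : FaithfulSMul K[X] S := (faithfulSMul_iff_algebraMap_injective _ _).2 hinj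
  have : Module.IsTorsionFree K[X] S := inferInstance
  set p : Ideal K[X] := Ideal.span {X} with hp
  have : p.IsMaximal := PrincipalIdealRing.isMaximal_of_irreducible irreducible_X
  have hmap : p.map (algebraMap K[X] S) ≤ P ^ 2 := by
    rw [hp, Ideal.map_span, Ideal.span_le]
    simpa using hP
  have : P.LiesOver p := ⟨by
    refine Ideal.IsMaximal.eq_of_le this (Ideal.comap_ne_top _ (Ideal.IsPrime.ne_top ‹_›)) ?_
    exact Ideal.map_le_iff_le_comap.1 (hmap.trans (Ideal.pow_le_self two_ne_zero))⟩
  have : PerfectField p.ResidueField := perfect_aux p hp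
  have hcard := Ideal.card_inertia_eq_ramificationIdxIn (G := Gal(L/k)) p P
  have hm0 : p.map (algebraMap K[X] S) ≠ ⊥ := by
    refine Ideal.map_ne_bot_of_ne_bot ?_
    simp [hp]
  rw [Ideal.ramificationIdxIn_eq_ramificationIdx p P Gal(L/k),
    Ideal.IsDedekindDomain.ramificationIdx_eq_multiplicity p P hm0] at hcard
  have h2 : 2 ≤ Nat.card (P.inertia Gal(L/k)) := by
    rw [hcard]
    refine FiniteMultiplicity.le_multiplicity_of_pow_dvd ?_ ?_
    · refine FiniteMultiplicity.of_prime_left (Ideal.prime_of_isPrime ?_ ‹_›) hm0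
      rintro rfl
      exact hm0 (le_bot_iff.1 (hmap.trans (Ideal.pow_le_self two_ne_zero)))
    · exact Ideal.dvd_iff_le.2 hmap
  have : Nontrivial (P.inertia Gal(L/k)) := Finite.one_lt_card_iff_nontrivial.1 h2
  obtain ⟨⟨σ, hσ⟩, h1⟩ := exists_ne (1 : P.inertia Gal(L/k))
  refine ⟨σ, fun h => h1 (Subtype.ext h), fun x y hxy => ?_⟩
  have := hσ x
  have e : σ • x = y := by
    apply Subtype.ext
    rw [← hxy]
    exact algebraMap_galRestrict_apply K[X] (K := k) (L := L) σ x
  rw [e] at this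
  exact this

/-- conjugacy -/
theorem conj_aux [FiniteDimensional k L] [IsGalois k L]
    (T : K[X]) (u v : L) (hu : (T.eval₂ ((algebraMap K[X] L).comp C) u) = algebraMap K[X] L X)
    (hv : (T.eval₂ ((algebraMap K[X] L).comp C) v) = algebraMap K[X] L X) :
    ∃ σ : Gal(L/k), σ u = v := by
  have hinj : Function.Injective (algebraMap K[X] L) := by
    rw [IsScalarTower.algebraMap_eq K[X] k L]
    exact (algebraMap k L).injective.comp (IsFractionRing.injective K[X] k)
  set c := (algebraMap K[X] L).comp C with hc
  -- key identity
  have key : ∀ w : L, T.eval₂ c w = algebraMap K[X] L X → ∀ A : K[X][X],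
      A.eval₂ (algebraMap K[X] L) w = (A.eval₂ (compRingHom T) X).eval₂ c w := by
    intro w hw A
    have h : (eval₂RingHom c w).comp (compRingHom T) = algebraMap K[X] L := by
      ext a
      · simp [hc]
      · simp [hw]
    rw [← coe_eval₂RingHom c w, hom_eval₂, h]
    simp
  have trans : ∀ Q : K[X], Q.eval₂ c u = 0 → Q = 0 := by
    let : Algebra K L := c.toAlgebra
    have ht : Transcendental K (algebraMap K[X] L X) := by
      rw [transcendental_iff]
      intro p hp
      apply hinj
      rw [map_zero, ← hp]
      have : (aeval (algebraMap K[X] L X) : K[X] →ₐ[K] L).toRingHom = algebraMap K[X] L := by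
        ext a
        · change aeval _ (C a) = _
          rw [aeval_C]; rfl
        · change aeval _ X = _
          rw [aeval_X]
      exact (congrArg (fun g : K[X] →+* L => g p) this).symm
    rw [← hu] at ht
    have hut : Transcendental K u := fun h =>
      ht (isAlgebraic_aeval_aux h T)
    rw [transcendental_iff] at hut
    exact hut
  have hroot : aeval v (minpoly k u) = 0 := by
    have h0 := IsLocalization.integerNormalization_aeval_eq_zero (nonZeroDivisors K[X])
      (minpoly k u) (minpoly.aeval k u)
    obtain ⟨b, hb, hb2⟩ := IsLocalization.integerNormalization_spec (nonZeroDivisors K[X])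
      (minpoly k u)
    set A := IsLocalization.integerNormalization (nonZeroDivisors K[X]) (minpoly k u)
    rw [aeval_def, key u hu] at h0
    have h1 := key v hv A
    rw [trans _ h0, eval₂_zero, ← aeval_def, ← aeval_map_algebraMap k, hb2] at h1
    rw [← IsScalarTower.algebraMap_smul k b, map_smul, smul_eq_zero] at h1
    refine h1.resolve_left ?_
    intro hb0
    exact nonZeroDivisors.ne_zero hb (IsFractionRing.injective K[X] k (hb0.trans (map_zero _).symm))
  have : minpoly k u = minpoly k v :=
    minpoly.eq_of_irreducible_of_monic (minpoly.irreducible (IsIntegral.of_finite k u)) hroot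
      (minpoly.monic (IsIntegral.of_finite k u))
  exact IsConjRoot.exists_algEquiv (this.symm)

theorem diff_aux {p a : ℕ} [Fact p.Prime] [CharP L p] (hq : 3 ≤ p ^ a) {t x y : L}
    (hx : x ^ p ^ a + x ^ 2 = t) (hy : y ^ p ^ a + y ^ 2 = t) (hxy : x ≠ y) :
    x + y = - (x - y) ^ (p ^ a - 1) := by
  have h := sub_pow_char_pow (R := L) (p := p) (n := a) x y
  have h1 : (x - y) ^ p ^ a = (x - y) ^ (p ^ a - 1) * (x - y) := by
    rw [← pow_succ]; congr 1; omega
  apply mul_right_cancel₀ (sub_ne_zero.2 hxy)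
  linear_combination h - h1 + hx - hy

theorem two_trans {p a : ℕ} [Fact p.Prime] [CharP L p] [CharP K p] (hq : 3 ≤ p ^ a) (h2 : p ≠ 2)
    [FiniteDimensional k L] [IsGalois k L] {x y x' y' : L}
    (hx : x ^ p ^ a + x ^ 2 = algebraMap K[X] L X) (hy : y ^ p ^ a + y ^ 2 = algebraMap K[X] L X)
    (hx' : x' ^ p ^ a + x' ^ 2 = algebraMap K[X] L X)
    (hy' : y' ^ p ^ a + y' ^ 2 = algebraMap K[X] L X)
    (hxy : x ≠ y) (hxy' : x' ≠ y') : ∃ σ : Gal(L/k), σ x = x' ∧ σ y = y' := by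
  have h2L : (2 : L) ≠ 0 := Ring.two_ne_zero (by rwa [ringChar.eq L p])
  have h2K : (2 : K) ≠ 0 := Ring.two_ne_zero (by rwa [ringChar.eq K p])
  have d := diff_aux hq hx hy hxy
  have d' := diff_aux hq hx' hy' hxy'
  have c2 : (algebraMap K[X] L) (C 2⁻¹) = 2⁻¹ := by
    apply eq_inv_of_mul_eq_one_left
    have : (2 : L) = algebraMap K[X] L (C 2) := by
      rw [map_ofNat C 2, map_ofNat]
    rw [this, ← map_mul, ← C_mul, inv_mul_cancel₀ h2K, C_1, map_one]
  obtain ⟨σ, hσ⟩ := conj_aux (K := K) (k := k) ((C 2⁻¹ * (X - X ^ (p ^ a - 1))) ^ p ^ a + (C 2⁻¹ * (X - X ^ (p ^ a - 1))) ^ 2)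
    (x - y) (x' - y') (by
      have : 2⁻¹ * (x - y - (x - y) ^ (p ^ a - 1)) = x := by
        field_simp; linear_combination -d
      simp only [eval₂_add, eval₂_pow, eval₂_mul, eval₂_sub, eval₂_C, eval₂_X,
        RingHom.comp_apply, c2, this, hx]) (by
      have : 2⁻¹ * (x' - y' - (x' - y') ^ (p ^ a - 1)) = x' := by
        field_simp; linear_combination -d'
      simp only [eval₂_add, eval₂_pow, eval₂_mul, eval₂_sub, eval₂_C, eval₂_X,
        RingHom.comp_apply, c2, this, hx'])
  have e1 : σ x - σ y = x' - y' := by rw [← map_sub, hσ]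
  have e2 : σ x + σ y = x' + y' := by rw [← map_add, d, map_neg, map_pow, hσ, d']
  refine ⟨σ, ?_, ?_⟩
  · apply mul_left_cancel₀ h2L; linear_combination e1 + e2
  · apply mul_left_cancel₀ h2L; linear_combination e2 - e1

theorem swap_exists {p a : ℕ} [Fact p.Prime] [CharP L p] [CharP K p] [PerfectField K]
    (hq : 3 ≤ p ^ a) (h2 : p ≠ 2)
    [FiniteDimensional k L] [IsGalois k L]
    (hgen : ∀ σ : Gal(L/k), (∀ x : L, x ^ p ^ a + x ^ 2 = algebraMap K[X] L X → σ x = x) → σ = 1)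
    (hs : ((X : L[X]) ^ p ^ a + X ^ 2 - C (algebraMap K[X] L X)).Splits) :
    ∃ σ : Gal(L/k), ∃ x y : L, x ≠ y ∧ x ^ p ^ a + x ^ 2 = algebraMap K[X] L X ∧
      σ x = y ∧ σ y = x ∧
      ∀ z, z ^ p ^ a + z ^ 2 = algebraMap K[X] L X → z ≠ x → z ≠ y → σ z = z := by
  have h2L : (2 : L) ≠ 0 := Ring.two_ne_zero (by rwa [ringChar.eq L p])
  have h2K : (2 : K) ≠ 0 := Ring.two_ne_zero (by rwa [ringChar.eq K p])
  let S := integralClosure K[X] L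
  have hint : ∀ x : L, x ^ p ^ a + x ^ 2 = algebraMap K[X] L X → x ∈ S := by
    intro x hx
    refine ⟨X ^ p ^ a + X ^ 2 - C X, ?_, ?_⟩
    · exact monic_aux hq _
    · simp [hx]
  have hinj : Function.Injective (algebraMap K[X] S) := by
    apply Function.Injective.of_comp (f := algebraMap S L)
    rw [← RingHom.coe_comp, ← IsScalarTower.algebraMap_eq, IsScalarTower.algebraMap_eq K[X] k L]
    exact (algebraMap k L).injective.comp (IsFractionRing.injective K[X] k)
  have : FaithfulSMul K[X] S := (faithfulSMul_iff_algebraMap_injective _ _).2 hinj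
  -- a prime above t
  have hp : (Ideal.span {(X : K[X])}).IsMaximal :=
    PrincipalIdealRing.isMaximal_of_irreducible irreducible_X
  obtain ⟨P, hPp, hPo⟩ : ∃ P : Ideal S, P.IsPrime ∧ P.LiesOver (Ideal.span {(X : K[X])}) := by
    obtain ⟨P⟩ := (inferInstance : Nonempty ((Ideal.span {(X : K[X])}).primesOver S))
    exact ⟨P.1, P.2.1, P.2.2⟩
  have htP : algebraMap K[X] S X ∈ P := by
    rw [← Ideal.mem_comap, ← Ideal.under_def, ← hPo.over]
    exact Ideal.mem_span_singleton_self _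
  -- a root in P
  set f : L[X] := X ^ p ^ a + X ^ 2 - C (algebraMap K[X] L X) with hf
  have hfm : f.Monic := monic_aux hq _
  have hroots : ∀ x ∈ f.roots, x ^ p ^ a + x ^ 2 = algebraMap K[X] L X := by
    intro x hx
    have := (mem_roots hfm.ne_zero).1 hx
    simpa [hf, sub_eq_zero] using this
  obtain ⟨x0, hx0P, hx0⟩ : ∃ x : S, x ∈ P ∧ (x : L) ^ p ^ a + (x : L) ^ 2 = algebraMap K[X] L X := by
    obtain ⟨m, hm⟩ : ∃ m : Multiset S, m.map (fun x : S => (x : L)) = f.roots := by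
      have : ∀ x ∈ f.roots, x ∈ S := fun x hx => hint x (hroots x hx)
      exact ⟨f.roots.pmap (fun x hx => ⟨x, hx⟩) this, by rw [Multiset.map_pmap]; exact (Multiset.pmap_eq_map _ _ _ this).trans (Multiset.map_id' _)⟩
    have h0 := hs.eval_eq_prod_roots_of_monic hfm 0
    have h1 : (m.map (fun x => 0 - x)).prod = - algebraMap K[X] S X := by
      apply Subtype.ext
      have h3 : f.eval 0 = - algebraMap K[X] L X := by
        have : p ^ a ≠ 0 := by omega
        rw [hf]; simp only [eval_sub, eval_add, eval_pow, eval_X, eval_C]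
        rw [zero_pow this, zero_pow two_ne_zero]; simp
      rw [h3, ← hm, Multiset.map_map] at h0
      change algebraMap S L _ = - algebraMap K[X] L X
      rw [h0, map_multiset_prod, Multiset.map_map]
      rfl
    have h4 : (m.map (fun x => 0 - x)).prod ∈ P := by rw [h1]; exact neg_mem htP
    obtain ⟨y, hy, hyP⟩ := (Ideal.IsPrime.multiset_prod_mem_iff_exists_mem hPp _).1 h4
    obtain ⟨x, hx, rfl⟩ := Multiset.mem_map.1 hy
    refine ⟨x, by simpa using hyP, hroots _ ?_⟩
    rw [← hm]; exact Multiset.mem_map_of_mem _ hx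
  have ht2 : algebraMap K[X] S X ∈ P ^ 2 := by
    have : algebraMap K[X] S X = x0 ^ 2 * (x0 ^ (p ^ a - 2) + 1) := by
      apply Subtype.ext
      change algebraMap K[X] L X = (x0 : L) ^ 2 * ((x0 : L) ^ (p ^ a - 2) + 1)
      rw [← hx0, mul_add, ← pow_add, mul_one]
      congr 2; omega
    rw [this]
    exact Ideal.mul_mem_right _ _ (Ideal.pow_mem_pow hx0P 2)
  obtain ⟨σ, hσ1, hσ⟩ := inertia_aux (k := k) P ht2
  have hσt : ∀ x, x ^ p ^ a + x ^ 2 = algebraMap K[X] L X →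
      (σ x) ^ p ^ a + (σ x) ^ 2 = algebraMap K[X] L X := by
    intro x hx
    rw [← map_pow, ← map_pow, ← map_add, hx, IsScalarTower.algebraMap_apply K[X] k L, σ.commutes]
  have h2S : ∀ x : S, 2 * x ∈ P → x ∈ P := by
    intro x hx
    refine (hPp.mem_or_mem hx).resolve_left fun h => hPp.ne_top ?_
    refine Ideal.eq_top_of_isUnit_mem _ h ?_
    have : (2 : S) = algebraMap K[X] S (C 2) := by
      rw [map_ofNat C 2, map_ofNat]
    rw [this]
    exact ((IsUnit.mk0 _ h2K).map C).map _
  -- moved roots are in P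
  have moved : ∀ x : S, (x : L) ^ p ^ a + (x : L) ^ 2 = algebraMap K[X] L X → σ x ≠ x → x ∈ P := by
    intro x hx hne
    have hy := hσt x hx
    obtain ⟨y, hy'⟩ : ∃ y : S, (y : L) = σ x := ⟨⟨_, hint _ hy⟩, rfl⟩
    have hd := hσ x y hy'.symm
    have e := diff_aux hq hy hx hne
    rw [← hy'] at e
    have e' : 2 * x = -(y - x) * ((y - x) ^ (p ^ a - 2) + 1) := by
      apply Subtype.ext
      change 2 * (x : L) = -((y : L) - x) * (((y : L) - x) ^ (p ^ a - 2) + 1)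
      have : ((y : L) - x) ^ (p ^ a - 1) = ((y : L) - x) * ((y : L) - x) ^ (p ^ a - 2) := by
        rw [← pow_succ']; congr 1; omega
      linear_combination e - this
    apply h2S
    rw [e']
    exact Ideal.mul_mem_right _ _ (neg_mem hd)
  -- at most two roots in P
  have two : ∀ x y z : S, (x : L) ^ p ^ a + (x : L) ^ 2 = algebraMap K[X] L X →
      (y : L) ^ p ^ a + (y : L) ^ 2 = algebraMap K[X] L X →
      (z : L) ^ p ^ a + (z : L) ^ 2 = algebraMap K[X] L X → x ∈ P → y ∈ P → z ∈ P →
      x ≠ y → x ≠ z → y ≠ z → False := by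
    intro x y z hx hy hz hxP hyP hzP hxy hxz hyz
    have e1 := diff_aux hq hx hy (fun h => hxy (Subtype.ext h))
    have e2 := diff_aux hq hx hz (fun h => hxz (Subtype.ext h))
    have e3 : (x - y) ^ (p ^ a - 1) - (x - z) ^ (p ^ a - 1) = (x - y) - (x - z) := by
      apply Subtype.ext
      change ((x : L) - y) ^ (p ^ a - 1) - ((x : L) - z) ^ (p ^ a - 1)
        = ((x : L) - y) - ((x : L) - z)
      linear_combination e1 - e2
    rw [← geom_sum₂_mul] at e3
    have e4 : ∑ i ∈ Finset.range (p ^ a - 1), (x - y) ^ i * (x - z) ^ (p ^ a - 1 - 1 - i) = 1 := by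
      apply mul_right_cancel₀ (b := (x - y) - (x - z))
      · rw [sub_sub_sub_cancel_left]; exact sub_ne_zero.2 (Ne.symm hyz)
      · rw [e3, one_mul]
    apply hPp.ne_top
    rw [Ideal.eq_top_iff_one, ← e4]
    refine Ideal.sum_mem _ fun i hi => ?_
    by_cases h : i = 0
    · subst h
      exact Ideal.mul_mem_left _ _ (Ideal.pow_mem_of_mem _ (sub_mem hxP hzP) _ (by omega))
    · exact Ideal.mul_mem_right _ _ (Ideal.pow_mem_of_mem _ (sub_mem hxP hyP) _ (by omega))
  obtain ⟨x, hx, hne⟩ : ∃ x : L, x ^ p ^ a + x ^ 2 = algebraMap K[X] L X ∧ σ x ≠ x := by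
    by_contra! h
    exact hσ1 (hgen σ h)
  have hy := hσt x hx
  have hz := hσt _ hy
  have hne2 : σ (σ x) ≠ σ x := fun h => hne (σ.injective h)
  have hxP := moved ⟨x, hint x hx⟩ hx hne
  have hyP := moved ⟨_, hint _ hy⟩ hy hne2
  have hfix : ∀ z, z ^ p ^ a + z ^ 2 = algebraMap K[X] L X → z ≠ x → z ≠ σ x → σ z = z := by
    intro z hz h1 h2
    by_contra h3
    have hzP := moved ⟨z, hint z hz⟩ hz h3
    refine two ⟨x, hint x hx⟩ ⟨_, hint _ hy⟩ ⟨z, hint z hz⟩ hx hy hz hxP hyP hzP ?_ ?_ ?_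
    · exact fun h => hne (congrArg Subtype.val h).symm
    · exact fun h => h1 (congrArg Subtype.val h).symm
    · exact fun h => h2 (congrArg Subtype.val h).symm
  refine ⟨σ, x, σ x, hne.symm, hx, rfl, ?_, hfix⟩
  by_contra h
  exact hne2 (σ.injective (hfix _ hz h hne2))
end

theorem aeval_aux {k L : Type*} [Field k] [Field L] [Algebra k L] (n : ℕ) (t : k) (x : L) :
    aeval x (X ^ n + X ^ 2 - C t) = x ^ n + x ^ 2 - algebraMap k L t := by
  simp

theorem map_aux {k L : Type*} [Field k] [Field L] [Algebra k L] (n : ℕ) (t : k) :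
    (X ^ n + X ^ 2 - C t).map (algebraMap k L) = X ^ n + X ^ 2 - C (algebraMap k L t) := by
  simp

theorem sep_aux {k : Type*} [Field k] {p a : ℕ} [Fact p.Prime] [CharP k p] (ha : 0 < a)
    (h2 : p ≠ 2) (hq : 3 ≤ p ^ a) (t : k) (ht : t ≠ 0) :
    ((X : k[X]) ^ p ^ a + X ^ 2 - C t).Separable := by
  have h2k : (2 : k) ≠ 0 := Ring.two_ne_zero (by rwa [ringChar.eq k p])
  have hd : derivative ((X : k[X]) ^ p ^ a + X ^ 2 - C t) = C 2 * X := by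
    have : (C 2 : k[X]) = 1 + 1 := by rw [one_add_one_eq_two]; rfl
    simp [derivative_X_pow, ha.ne', this]
  rw [Separable, hd]
  refine ⟨C (-t⁻¹), C (t⁻¹ * 2⁻¹) * (X ^ (p ^ a - 1) + X), ?_⟩
  have e1 : (X : k[X]) ^ p ^ a = X ^ (p ^ a - 1) * X := by
    rw [← pow_succ]; congr 1; omega
  have e2 : (C (t⁻¹) : k[X]) * C t = 1 := by rw [← C_mul, inv_mul_cancel₀ ht, C_1]
  have e3 : (C (2⁻¹) : k[X]) * C 2 = 1 := by rw [← C_mul, inv_mul_cancel₀ h2k, C_1]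
  rw [e1, C_mul, C_neg]
  linear_combination e2 + C t⁻¹ * (X ^ (p ^ a - 1) + X) * X * e3

/-- **Proposition 4.2 (geometric part).** Let `q` be a power of an odd prime and
`f = X^q + X^2 ∈ F_q[X]`. The Galois group of `f - t` over `F̄_q(t)` (the geometric
monodromy group of `f`) is the full symmetric group `S_q`, i.e. it has cardinality `q!`. -/
theorem stmt_6 (p a : ℕ) [Fact p.Prime] (hodd : Odd p) (ha : 0 < a)
    (F : Type) [Field F] [Fintype F] (hF : Fintype.card F = p ^ a) :
    Nat.card ((X : Polynomial (RatFunc (AlgebraicClosure F))) ^ p ^ a + X ^ 2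
        - C RatFunc.X).Gal = Nat.factorial (p ^ a) := by
  classical
  have h2 : p ≠ 2 := by rintro rfl; exact absurd hodd (by decide)
  have hp3 : 3 ≤ p := by
    have := (Fact.out : p.Prime).two_le
    omega
  have hq : 3 ≤ p ^ a := hp3.trans (Nat.le_self_pow ha.ne' p)
  have : CharP F p := charP_of_card_eq_prime_pow hF
  let K := AlgebraicClosure F
  have : CharP K p := charP_of_injective_algebraMap (algebraMap F K).injective p
  let k := RatFunc K
  have : CharP k p := charP_of_injective_algebraMap (algebraMap K k).injective p
  set f : k[X] := X ^ p ^ a + X ^ 2 - C RatFunc.X with hf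
  let L := f.SplittingField
  have : CharP L p := charP_of_injective_algebraMap (algebraMap k L).injective p
  have hsep : f.Separable := sep_aux ha h2 hq _ RatFunc.X_ne_zero
  have : IsGalois k L := IsGalois.of_separable_splitting_field hsep
  have hX : algebraMap k L RatFunc.X = algebraMap K[X] L X := by
    rw [IsScalarTower.algebraMap_apply K[X] k L, RatFunc.algebraMap_X]
  have hfm : f.Monic := monic_aux hq _
  have hmem : ∀ x : L, x ∈ f.rootSet L ↔ x ^ p ^ a + x ^ 2 = algebraMap K[X] L X := by
    intro x
    rw [mem_rootSet_of_ne hfm.ne_zero, ← hX, ← sub_eq_zero (b := algebraMap k L RatFunc.X)]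
    exact Eq.congr_left (aeval_aux (p ^ a) RatFunc.X x)
  have hsL : (f.map (algebraMap k L)).Splits := SplittingField.splits f
  have : Fact (f.map (algebraMap k L)).Splits := ⟨hsL⟩
  obtain ⟨σ, x, y, hxy, hx, hσx, hσy, hσz⟩ := swap_exists (K := K) (k := k) (L := L) hq h2
    (fun σ h => Gal.ext f (fun x hx => h x ((hmem x).1 hx)))
    (by
      have : (X : L[X]) ^ p ^ a + X ^ 2 - C (algebraMap K[X] L X) = f.map (algebraMap k L) := by
        rw [← hX]; exact (map_aux _ _).symm
      rw [this]; exact hsL)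
  have hy : y ^ p ^ a + y ^ 2 = algebraMap K[X] L X := by
    rw [← hσx, ← map_pow, ← map_pow, ← map_add, hx, IsScalarTower.algebraMap_apply K[X] k L,
      σ.commutes]
  have hswap : Gal.galActionHom f L (Gal.restrict f L σ) =
      Equiv.swap (⟨x, (hmem x).2 hx⟩ : f.rootSet L) ⟨y, (hmem y).2 hy⟩ := by
    ext z
    rw [Gal.galActionHom_restrict, Equiv.swap_apply_def]
    split_ifs with h1 h2
    · rw [h1]; exact hσx
    · rw [h2]; exact hσy
    · exact hσz z ((hmem z).1 z.2) (fun h => h1 (Subtype.ext h)) (fun h => h2 (Subtype.ext h))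
  have hsurj : Function.Surjective (Gal.galActionHom f L) := by
    rw [← MonoidHom.range_eq_top, eq_top_iff, ← Equiv.Perm.closure_isSwap, Subgroup.closure_le]
    rintro _ ⟨b, c, hbc, rfl⟩
    obtain ⟨τ, hτx, hτy⟩ := two_trans (K := K) (k := k) hq h2 hx hy ((hmem _).1 b.2)
      ((hmem _).1 c.2) hxy (fun h => hbc (Subtype.ext h))
    refine ⟨Gal.restrict f L τ * Gal.restrict f L σ * (Gal.restrict f L τ)⁻¹, ?_⟩
    rw [map_mul, map_mul, map_inv, hswap, ← Equiv.swap_apply_apply]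
    congr 1
    · exact Subtype.ext ((Gal.galActionHom_restrict f L τ _).trans hτx)
    · exact Subtype.ext ((Gal.galActionHom_restrict f L τ _).trans hτy)
  have hbij : Function.Bijective (Gal.galActionHom f L) := ⟨Gal.galActionHom_injective f L, hsurj⟩
  rw [Nat.card_congr (Equiv.ofBijective _ hbij), Nat.card_perm, Nat.card_eq_fintype_card,
    card_rootSet_eq_natDegree hsep (SplittingField.splits f)]
  exact congrArg _ (natDegree_aux hq _)
end

section
/- Let q be a power of an odd prime. Then there exists a positive integer d₀ such that the polynomial X^q + X^2 ∈ F_q[X] is d-universal for every integer d > d₀. -/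
open Polynomial

/-- `f ∈ F_q[X]` is `d`-universal if for every positive `ℓ ≤ deg f` there is
`t₀ ∈ F_{q^d}` such that `f - t₀` has an irreducible factor of degree `ℓ` over `F_{q^d}`. -/
def IsDUniversal {F : Type} [Field F] [Fintype F] (f : Polynomial F) (d : ℕ) : Prop :=
  ∀ (K : Type) [Field K] [Fintype K] [Algebra F K],
    Fintype.card K = Fintype.card F ^ d →
    ∀ ℓ : ℕ, 0 < ℓ → ℓ ≤ f.natDegree →
      ∃ t₀ : K, ∃ g : Polynomial K,
        Irreducible g ∧ g.natDegree = ℓ ∧ g ∣ (f.map (algebraMap F K) - C t₀)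


theorem exists_usa (n : ℕ) : ∀ (A : Type) [CommRing A] [Nontrivial A] (f : A[X]), f.Monic →
    f.natDegree = n → ∃ (S : Type) (_ : CommRing S) (_ : Algebra A S) (x : Fin n → S)
      (ι : Type) (_ : Fintype ι) (b : Module.Basis ι A S) (μ : ι → Fin n → ℕ),
      Fintype.card ι = n.factorial ∧ (∀ i, b i = ∏ j, x j ^ μ i j) ∧
      f.map (algebraMap A S) = ∏ j, (X - C (x j)) ∧
      ∀ (B : Type) [CommRing B] (φ : A →+* B) (y : Fin n → B),
        f.map φ = ∏ j, (X - C (y j)) →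
        ∃ ψ : S →+* B, ψ.comp (algebraMap A S) = φ ∧ ∀ j, ψ (x j) = y j := by
  induction n with
  | zero =>
    intro A _ _ f hf hn
    have hf1 : f = 1 := hf.natDegree_eq_zero.mp hn
    refine ⟨A, inferInstance, Algebra.id A, Fin.elim0, Unit, inferInstance,
      Module.Basis.singleton Unit A, fun _ => Fin.elim0, by simp, by simp, by simp [hf1], ?_⟩
    intro B _ φ y _
    exact ⟨φ, by ext; simp, fun j => j.elim0⟩
  | succ n ih =>
    intro A _ _ f hf hn
    have : Nontrivial (AdjoinRoot f) := by
      refine Ideal.Quotient.nontrivial_iff.mpr ?_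
      rw [Ne, Ideal.span_singleton_eq_top]
      intro hu
      rw [hf.eq_one_of_isUnit hu] at hn
      simp at hn
    set r := AdjoinRoot.root f with hr
    have hroot : (f.map (AdjoinRoot.of f)).IsRoot r := by
      rw [IsRoot, eval_map, hr, AdjoinRoot.eval₂_root]
    set g := (f.map (AdjoinRoot.of f)) /ₘ (X - C r) with hg
    have hfac : (X - C r) * g = f.map (AdjoinRoot.of f) := mul_divByMonic_eq_iff_isRoot.mpr hroot
    have hgm : g.Monic := by
      refine Monic.of_mul_monic_left (monic_X_sub_C r) ?_
      rw [hfac]; exact hf.map _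
    have hgn : g.natDegree = n := by
      rw [hg, natDegree_divByMonic _ (monic_X_sub_C r), hf.natDegree_map, hn, natDegree_X_sub_C]
      omega
    obtain ⟨S, _, _, x, ι, _, b, μ, hc, hb, hsplit, huniv⟩ := ih (AdjoinRoot f) g hgm hgn
    let : Algebra A S := ((algebraMap (AdjoinRoot f) S).comp (AdjoinRoot.of f)).toAlgebra
    have : IsScalarTower A (AdjoinRoot f) S := IsScalarTower.of_algebraMap_eq' rfl
    refine ⟨S, inferInstance, inferInstance, Fin.cons (algebraMap (AdjoinRoot f) S r) x,
      Fin (AdjoinRoot.powerBasis' hf).dim × ι, inferInstance,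
      (AdjoinRoot.powerBasis' hf).basis.smulTower b,
      fun i => Fin.cons (i.1 : ℕ) (μ i.2), ?_, ?_, ?_, ?_⟩
    · simp [hc, hn, Nat.factorial_succ]
    · rintro ⟨i, j⟩
      rw [Module.Basis.smulTower_apply, PowerBasis.basis_eq_pow, AdjoinRoot.powerBasis'_gen, hb,
        Algebra.smul_def, Fin.prod_univ_succ]
      simp [hr]
    · have : algebraMap A S = (algebraMap (AdjoinRoot f) S).comp (AdjoinRoot.of f) := rfl
      rw [this, ← Polynomial.map_map, ← hfac, Polynomial.map_mul, hsplit, Fin.prod_univ_succ]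
      simp
    · intro B _ φ y hy
      have hy0 : f.eval₂ φ (y 0) = 0 := by
        rw [← eval_map, hy, Fin.prod_univ_succ]; simp
      set φ' := AdjoinRoot.lift φ (y 0) hy0 with hφ'
      have hcomp : φ'.comp (AdjoinRoot.of f) = φ := by
        ext a; simp [hφ']
      have hr' : φ' r = y 0 := by simp [hφ', hr]
      have hgy : g.map φ' = ∏ j : Fin n, (X - C (y j.succ)) := by
        apply (monic_X_sub_C (y 0)).isRegular.left
        have h1 := congrArg (Polynomial.map φ') hfac
        rw [Polynomial.map_map, hcomp, hy, Fin.prod_univ_succ, Polynomial.map_mul] at h1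
        simpa [hr'] using h1
      obtain ⟨ψ, hψ, hψx⟩ := huniv B φ' (fun j => y j.succ) hgy
      refine ⟨ψ, ?_, ?_⟩
      · have : algebraMap A S = (algebraMap (AdjoinRoot f) S).comp (AdjoinRoot.of f) := rfl
        rw [this, ← RingHom.comp_assoc, hψ, hcomp]
      · intro j
        refine Fin.cases ?_ (fun j => ?_) j
        · simp only [Fin.cons_zero]
          rw [← hr', ← hψ]; rfl
        · simpa using hψx j


section Stepanov

variable {k : Type} [Field k]

/-- A sum of power series with pairwise distinct orders is nonzero. -/
theorem ps_sum_ne_zero {ι : Type} (s : Finset ι) (z : ι → PowerSeries k)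
    (hd : ∀ i ∈ s, ∀ j ∈ s, z i ≠ 0 → z j ≠ 0 → (z i).order = (z j).order → i = j)
    (hne : ∃ i ∈ s, z i ≠ 0) : ∑ i ∈ s, z i ≠ 0 := by
  classical
  obtain ⟨i₀, hi₀, hz₀⟩ := hne
  obtain ⟨i, hi, hmin⟩ := (s.filter (fun i => z i ≠ 0)).exists_min_image (fun i => (z i).order)
    ⟨i₀, by simp [hi₀, hz₀]⟩
  rw [Finset.mem_filter] at hi
  intro h
  have h1 := congrArg (PowerSeries.coeff (z i).order.toNat) h
  rw [map_sum, map_zero, Finset.sum_eq_single i] at h1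
  · exact PowerSeries.coeff_order hi.2 h1
  · intro j hj hji
    by_cases hzj : z j = 0
    · simp [hzj]
    · apply PowerSeries.coeff_of_lt_order
      rw [PowerSeries.coe_toNat_order hi.2]
      refine lt_of_le_of_ne (hmin j (by simp [hj, hzj])) ?_
      intro he
      exact hji (hd i hi.1 j hj hi.2 hzj he).symm
  · intro h'; exact absurd hi.1 h'

/-- Finite-dimensional spaces of power series: bounded orders. -/
theorem ps_order_bdd (U : Submodule k (PowerSeries k)) [FiniteDimensional k U] :
    ∃ N : ℕ, ∀ z ∈ U, z ≠ 0 → z.order ≤ N := by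
  classical
  set O : Set ℕ := {n | ∃ z ∈ U, z ≠ 0 ∧ z.order = n} with hO
  have hfin : O.Finite := by
    by_contra hinf
    obtain ⟨T, hT, hcard⟩ := (show O.Infinite from hinf).exists_subset_card_eq
      (Module.finrank k U + 1)
    have hch : ∀ n : T, ∃ z : U, (z : PowerSeries k) ≠ 0 ∧ (z : PowerSeries k).order = (n : ℕ) := by
      rintro ⟨n, hn⟩
      obtain ⟨z, hz, h1, h2⟩ := hT hn
      exact ⟨⟨z, hz⟩, h1, h2⟩
    choose z hz0 hz using hch
    have hli : LinearIndependent k z := by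
      rw [Fintype.linearIndependent_iff]
      intro g hg
      by_contra! hne
      obtain ⟨i, hi⟩ := hne
      refine ps_sum_ne_zero Finset.univ (fun n => g n • (z n : PowerSeries k)) ?_ ?_ ?_
      · intro i _ j _ h1 h2 h3
        have e1 : ∀ n : T, g n • (z n : PowerSeries k) ≠ 0 →
            (g n • (z n : PowerSeries k)).order = (n : ℕ) := by
          intro n hn
          have hgn : g n ≠ 0 := fun h => hn (by simp [h])
          rw [PowerSeries.smul_eq_C_mul, PowerSeries.order_mul, hz n, PowerSeries.order_zero_of_unit,
            zero_add]
          exact (isUnit_iff_ne_zero.mpr hgn).map PowerSeries.C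
        rw [e1 i h1, e1 j h2] at h3
        exact Subtype.ext (by exact_mod_cast h3)
      · exact ⟨i, Finset.mem_univ _, smul_ne_zero hi (hz0 i)⟩
      · have := congrArg (Subtype.val) hg
        simpa using this
    have := hli.fintype_card_le_finrank
    simp [hcard] at this
  obtain ⟨N, hN⟩ := hfin.bddAbove
  refine ⟨N, fun z hz h0 => ?_⟩
  have : z.order.toNat ∈ O := ⟨z, hz, h0, (PowerSeries.coe_toNat_order h0).symm⟩
  rw [← PowerSeries.coe_toNat_order h0]
  exact_mod_cast hN this

/-- Finite-dimensional spaces of power series: there are enough distinct orders. -/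
theorem ps_order_many (U : Submodule k (PowerSeries k)) [FiniteDimensional k U] :
    ∃ B : Fin (Module.finrank k U) → PowerSeries k, (∀ i, B i ∈ U) ∧ (∀ i, B i ≠ 0) ∧
      ∀ i j, (B i).order = (B j).order → i = j := by
  classical
  obtain ⟨N, hN⟩ := ps_order_bdd U
  set O : Finset ℕ := (Finset.range (N + 1)).filter (fun n => ∃ z ∈ U, z ≠ 0 ∧ z.order = n) with hO
  have hle : Module.finrank k U ≤ O.card := by
    let φ : U →ₗ[k] (O → k) :=
      LinearMap.pi (fun n : O => (PowerSeries.coeff (n : ℕ)) ∘ₗ U.subtype)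
    have hφ : Function.Injective φ := by
      rw [← LinearMap.ker_eq_bot, LinearMap.ker_eq_bot']
      rintro ⟨z, hz⟩ h
      by_contra hne
      have h0 : z ≠ 0 := fun h => hne (by simp [h])
      have hmem : z.order.toNat ∈ O := by
        rw [hO, Finset.mem_filter, Finset.mem_range]
        refine ⟨?_, z, hz, h0, (PowerSeries.coe_toNat_order h0).symm⟩
        have := hN z hz h0
        rw [← PowerSeries.coe_toNat_order h0] at this
        have : z.order.toNat ≤ N := by exact_mod_cast this
        omega
      have := congrFun h ⟨_, hmem⟩
      exact PowerSeries.coeff_order h0 this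
    have := LinearMap.finrank_le_finrank_of_injective hφ
    simpa using this
  obtain ⟨T, hT, hcard⟩ := Finset.exists_subset_card_eq hle
  have hch : ∀ n : T, ∃ z ∈ U, z ≠ 0 ∧ z.order = (n : ℕ) := by
    rintro ⟨n, hn⟩
    exact (Finset.mem_filter.mp (hT hn)).2
  choose z hzU hz0 hz using hch
  let e : Fin (Module.finrank k U) ≃ T := (Fintype.equivFinOfCardEq (by simp [hcard])).symm
  refine ⟨fun i => z (e i), fun i => hzU _, fun i => hz0 _, fun i j h => ?_⟩
  rw [hz, hz] at h
  exact e.injective (Subtype.ext (by exact_mod_cast h))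

end Stepanov


section Filtration

variable {k : Type} [Field k] {S : Type} [CommRing S] [Algebra k[X] S] [Algebra k S]
  [IsScalarTower k k[X] S] {ι : Type} [Fintype ι]

/-- elements all of whose coordinates have degree less than `m` -/
noncomputable def filt (b : Module.Basis ι k[X] S) (m : ℕ) : Submodule k S :=
  (Submodule.pi Set.univ (fun _ : ι => degreeLT k m)).comap
    (b.equivFun.restrictScalars k : S ≃ₗ[k] (ι → k[X])).toLinearMap

theorem mem_filt (b : Module.Basis ι k[X] S) (m : ℕ) (z : S) :
    z ∈ filt b m ↔ ∀ i, (b.equivFun z i).degree < m := by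
  simp [filt, Submodule.mem_pi, mem_degreeLT]

theorem filt_mono (b : Module.Basis ι k[X] S) {m l : ℕ} (h : m ≤ l) : filt b m ≤ filt b l := by
  intro z hz
  rw [mem_filt] at hz ⊢
  intro i
  exact lt_of_lt_of_le (hz i) (by exact_mod_cast h)

theorem exists_mem_filt (b : Module.Basis ι k[X] S) (z : S) : ∃ m, z ∈ filt b m := by
  refine ⟨(Finset.univ.sup fun i => (b.equivFun z i).natDegree) + 1, ?_⟩
  rw [mem_filt]
  intro i
  refine lt_of_le_of_lt degree_le_natDegree ?_
  have := Finset.le_sup (f := fun i => (b.equivFun z i).natDegree) (Finset.mem_univ i)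
  exact_mod_cast Nat.lt_succ_of_le this

noncomputable def filtEquiv (b : Module.Basis ι k[X] S) (m : ℕ) :
    filt b m ≃ₗ[k] (ι → degreeLT k m) where
  toFun z i := ⟨b.equivFun z.1 i, mem_degreeLT.mpr ((mem_filt b m _).mp z.2 i)⟩
  map_add' x y := by ext; simp
  map_smul' c x := by
    ext i : 2
    have := congrFun ((b.equivFun.restrictScalars k : S ≃ₗ[k] (ι → k[X])).map_smul c x.1) i
    exact this
  invFun w := ⟨b.equivFun.symm (fun i => (w i).1), by
    rw [mem_filt]; intro i; rw [LinearEquiv.apply_symm_apply]; exact mem_degreeLT.mp (w i).2⟩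
  left_inv z := by ext; simp
  right_inv w := by
    ext i : 2
    exact congrFun (b.equivFun.apply_symm_apply (fun i => (w i).1)) i

instance filt_fd (b : Module.Basis ι k[X] S) (m : ℕ) : FiniteDimensional k (filt b m) := by
  have : FiniteDimensional k (degreeLT k m) := Module.Finite.equiv (degreeLTEquiv k m).symm
  exact Module.Finite.equiv (filtEquiv b m).symm

theorem finrank_filt (b : Module.Basis ι k[X] S) (m : ℕ) :
    Module.finrank k (filt b m) = Fintype.card ι * m := by
  have : FiniteDimensional k (degreeLT k m) := Module.Finite.equiv (degreeLTEquiv k m).symm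
  rw [(filtEquiv b m).finrank_eq, Module.finrank_pi_fintype]
  simp [(degreeLTEquiv k m).finrank_eq]

theorem smul_mem_filt (b : Module.Basis ι k[X] S) {m l : ℕ} {a : k[X]} (ha : a.degree < m) {z : S}
    (hz : z ∈ filt b l) : a • z ∈ filt b (m + l) := by
  rw [mem_filt] at hz ⊢
  intro i
  simp only [map_smul, Pi.smul_apply, smul_eq_mul, degree_mul]
  by_cases h0 : b.equivFun z i = 0
  · rw [h0]; simp
  by_cases h1 : a = 0
  · rw [h1]; simp
  have h2 := hz i
  rw [degree_eq_natDegree h0] at h2 ⊢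
  rw [degree_eq_natDegree h1] at ha ⊢
  norm_cast at *
  omega

theorem sum_mem_filt (b : Module.Basis ι k[X] S) {m l : ℕ} {w : ι → S}
    (hw : ∀ i, w i ∈ filt b l) {z : S} (hz : z ∈ filt b m) :
    ∑ i, b.equivFun z i • w i ∈ filt b (m + l) :=
  Submodule.sum_mem _ fun i _ => smul_mem_filt b ((mem_filt b m z).mp hz i) (hw i)

theorem exists_bound_family (b : Module.Basis ι k[X] S) {κ : Type} [Finite κ] (w : κ → S) :
    ∃ c, ∀ i, w i ∈ filt b c := by
  have := Fintype.ofFinite κ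
  choose c hc using fun i => exists_mem_filt b (w i)
  exact ⟨Finset.univ.sup c, fun i => filt_mono b (Finset.le_sup (Finset.mem_univ i)) (hc i)⟩

theorem exists_mul_const (b : Module.Basis ι k[X] S) :
    ∃ c : ℕ, 1 ∈ filt b c ∧ ∀ m l : ℕ, ∀ z ∈ filt b m, ∀ w ∈ filt b l,
      z * w ∈ filt b (m + l + c) := by
  obtain ⟨c, hc⟩ := exists_bound_family b (fun ij : ι × ι => b ij.1 * b ij.2)
  obtain ⟨c', hc'⟩ := exists_mem_filt b (1 : S)
  refine ⟨max c c', filt_mono b (le_max_right _ _) hc', ?_⟩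
  intro m l z hz w hw
  refine filt_mono b (l := m + l + max c c') (m := m + (l + c)) (by omega) ?_
  have h1 : z * w = ∑ i, b.equivFun z i • (b i * w) := by
    conv_lhs => rw [← b.sum_equivFun z, Finset.sum_mul]
    simp
  rw [h1]
  refine sum_mem_filt b (fun i => ?_) hz
  have h2 : b i * w = ∑ j, b.equivFun w j • (b i * b j) := by
    conv_lhs => rw [← b.sum_equivFun w, Finset.mul_sum]
    simp
  rw [h2]
  exact sum_mem_filt b (fun j => hc (i, j)) hw

theorem pow_mem_filt (b : Module.Basis ι k[X] S) {c : ℕ} (h1 : 1 ∈ filt b c)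
    (hc : ∀ m l : ℕ, ∀ z ∈ filt b m, ∀ w ∈ filt b l, z * w ∈ filt b (m + l + c))
    {m : ℕ} {z : S} (hz : z ∈ filt b m) (r : ℕ) : z ^ r ∈ filt b (r * (m + c) + c) := by
  induction r with
  | zero => simpa using h1
  | succ r ih =>
    rw [pow_succ]
    have := hc _ _ _ ih _ hz
    convert this using 2
    ring

/-- zero estimate -/
theorem zero_estimate [IsDomain S] (b : Module.Basis ι k[X] S) {c : ℕ}
    (hc : ∀ m l : ℕ, ∀ z ∈ filt b m, ∀ w ∈ filt b l, z * w ∈ filt b (m + l + c))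
    {D : ℕ} {g : S} (hg0 : g ≠ 0) (hg : g ∈ filt b D) {Y : Type} [Fintype Y]
    (y : Y → (S →ₐ[k] k)) (hy : Function.Injective y) (hyg : ∀ i, y i g = 0) :
    Fintype.card Y ≤ Fintype.card ι * (D + c) := by
  classical
  let E : S →ₗ[k] (Y → k) := LinearMap.pi (fun i => (y i).toLinearMap)
  have hE : Function.Surjective E := by
    rw [← LinearMap.range_eq_top]
    by_contra hne
    obtain ⟨φ, hφ0, hφ⟩ := Submodule.exists_dual_map_eq_bot_of_lt_top
      (lt_top_iff_ne_top.mpr hne) inferInstance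
    apply hφ0
    have hli := (linearIndependent_monoidHom S k).comp (fun i : Y => ((y i : S →ₐ[k] k) : S →* k))
      (fun i j h => hy (by ext s; exact DFunLike.congr_fun h s))
    rw [Fintype.linearIndependent_iff] at hli
    have key := hli (fun i => φ (Pi.single i 1)) (by
      ext s
      have h1 : φ (E s) = 0 := by
        have : φ (E s) ∈ Submodule.map φ (LinearMap.range E) := ⟨E s, ⟨s, rfl⟩, rfl⟩
        rw [hφ] at this
        exact (Submodule.mem_bot k).mp this
      rw [LinearMap.pi_apply_eq_sum_univ φ (E s)] at h1
      simp only [Finset.sum_apply, Pi.smul_apply, smul_eq_mul, Pi.zero_apply]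
      rw [← h1]
      refine Finset.sum_congr rfl fun i _ => ?_
      rw [smul_eq_mul, mul_comm]
      congr 2
      ext j; simp [Pi.single_apply, eq_comm])
    refine LinearMap.pi_ext' fun i => ?_
    ext
    simpa using key i
  choose s hs using fun i : Y => hE (Pi.single i 1)
  obtain ⟨m₀, hm₀⟩ := exists_bound_family b s
  set m := m₀ + (D + c) with hm
  let Em : filt b m →ₗ[k] (Y → k) := E ∘ₗ (filt b m).subtype
  have hEm : Function.Surjective Em := by
    intro w
    refine ⟨⟨∑ i, w i • s i, Submodule.sum_mem _ fun i _ => Submodule.smul_mem _ _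
      (filt_mono b (by omega) (hm₀ i))⟩, ?_⟩
    simp only [Em, LinearMap.comp_apply, Submodule.subtype_apply, map_sum, map_smul, hs]
    ext j
    simp [Finset.sum_apply, Pi.single_apply]
  have hrn := LinearMap.finrank_range_add_finrank_ker Em
  rw [LinearMap.range_eq_top.mpr hEm, finrank_top, Module.finrank_fintype_fun_eq_card,
    finrank_filt] at hrn
  let μ : filt b m₀ →ₗ[k] LinearMap.ker Em :=
    { toFun := fun z => ⟨⟨g * z.1, filt_mono b (by omega) (hc _ _ _ hg _ z.2)⟩, by
        ext i
        simp [Em, E, hyg]⟩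
      map_add' := fun z w => by ext; simp [mul_add]
      map_smul' := fun r z => by ext; simp }
  have hμ : Function.Injective μ := by
    intro z w h
    have : g * z.1 = g * w.1 := congrArg (fun u => u.1.1) h
    exact Subtype.ext (mul_left_cancel₀ hg0 this)
  have := LinearMap.finrank_le_finrank_of_injective hμ
  rw [finrank_filt] at this
  have h3 : Fintype.card ι * m = Fintype.card ι * m₀ + Fintype.card ι * (D + c) := by
    rw [hm, mul_add]
  omega

end Filtration


section Main

variable {k : Type} [Field k] {S : Type} [CommRing S] [Algebra k[X] S] [Algebra k S]
  [IsScalarTower k k[X] S] {ι : Type} [Fintype ι]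

theorem frob_mem_filt (b : Module.Basis ι k[X] S) {m c₁ : ℕ} (φ : k →+* k) (Φ : S →+* S)
    (hΦc : ∀ c : k, Φ (algebraMap k S c) = algebraMap k S (φ c))
    (hΦX : Φ (algebraMap k[X] S X) = algebraMap k[X] S X)
    (hΦb : ∀ i, Φ (b i) ∈ filt b c₁) {z : S} (hz : z ∈ filt b m) : Φ z ∈ filt b (m + c₁) := by
  have hA : ∀ a : k[X], Φ (algebraMap k[X] S a) = algebraMap k[X] S (a.map φ) := by
    intro a
    have : (Φ.comp (algebraMap k[X] S)) = (algebraMap k[X] S).comp (mapRingHom φ) := by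
      refine Polynomial.ringHom_ext (fun c => ?_) ?_
      · have h1 := hΦc c
        rw [IsScalarTower.algebraMap_apply k k[X] S, IsScalarTower.algebraMap_apply k k[X] S] at h1
        simpa using h1
      · simpa using hΦX
    exact DFunLike.congr_fun this a
  rw [mem_filt] at hz
  rw [← b.sum_equivFun z, map_sum]
  refine Submodule.sum_mem _ fun i _ => ?_
  rw [Algebra.smul_def, map_mul, hA, ← Algebra.smul_def]
  exact smul_mem_filt b (lt_of_le_of_lt (degree_map_le) (hz i)) (hΦb i)

theorem stepanov {p : ℕ} [Fact p.Prime] [CharP k p] [IsAlgClosed k]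
    (b : Module.Basis ι k[X] S) (v : S →ₐ[k] PowerSeries k) (hv : Function.Injective v)
    (M c₁ : ℕ) (hM : 0 < M) : ∃ e₀ : ℕ, ∀ e ≥ e₀, ∀ Φ : S →+* S,
      (∀ c : k, Φ (algebraMap k S c) = algebraMap k S (c ^ p ^ e)) →
      Φ (algebraMap k[X] S X) = algebraMap k[X] S X →
      (∀ i, Φ (b i) ∈ filt b c₁) →
      ∀ (Y : Type) [Fintype Y] (y : Y → (S →ₐ[k] k)), Function.Injective y →
        (∀ i z, y i (Φ z) = (y i z) ^ p ^ e) →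
        M * Fintype.card Y ≤ (M + 1) * p ^ e := by
  classical
  have hp : p.Prime := Fact.out
  have hdom : IsDomain S := hv.isDomain (v : S →+* PowerSeries k)
  have hne : Nonempty ι := b.index_nonempty
  set h := Fintype.card ι with hh
  have hpos : 0 < h := Fintype.card_pos
  have hSchar : CharP S p := charP_of_injective_algebraMap (algebraMap k S).injective p
  obtain ⟨c, h1, hc⟩ := exists_mul_const b
  -- choose `a`
  set a := 2 * M * (c + 3) with ha
  obtain ⟨N, hN⟩ := ps_order_bdd ((filt b a).map v.toLinearMap)
  -- choose `P = p ^ m`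
  obtain ⟨m, hm⟩ : ∃ m : ℕ, h + c₁ + 2 * c + 1 + 2 * M * h * (1 + c) + 1 ≤ p ^ m :=
    ⟨_, (Nat.lt_pow_self hp.one_lt).le⟩
  set P := p ^ m with hP
  have hPpos : 0 < P := Nat.pow_pos hp.pos
  set β := (2 * M + 1) * P / (2 * M * h) + 1 with hβ
  have hβ1 : (2 * M + 1) * P < 2 * M * h * β := Nat.lt_mul_div_succ _ (by positivity)
  have hβ2 : 2 * M * h * β ≤ (2 * M + 1) * P + 2 * M * h := by
    have := Nat.mul_div_le ((2 * M + 1) * P) (2 * M * h)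
    rw [hβ, mul_add, mul_one]
    omega
  -- the count of unknowns
  have hcount : P * (a + c) + c + (β + c₁) + c < h * a * β := by
    have e1 : h * a * β = (c + 3) * (2 * M * h * β) := by rw [ha]; ring
    have e2 : (c + 3) * ((2 * M + 1) * P) ≤ (c + 3) * (2 * M * h * β) :=
      Nat.mul_le_mul_left _ hβ1.le
    have e3 : (c + 3) * ((2 * M + 1) * P) = P * a + c * P + 3 * P := by rw [ha]; ring
    have e4 : β ≤ h * β := Nat.le_mul_of_pos_left _ hpos
    have e5 : h * β ≤ 2 * P + h := by
      have : 2 * M * (h * β) ≤ 2 * M * (2 * P + h) := by nlinarith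
      exact Nat.le_of_mul_le_mul_left this (by positivity)
    have e6 : P * (a + c) = P * a + c * P := by ring
    have e7 : h + c₁ + 2 * c + 1 ≤ P := by omega
    rw [e1]
    omega
  obtain ⟨r₀, hr₀⟩ : ∃ r₀ : ℕ, N + 1 + 2 * M * h * (a + 3 * c) ≤ p ^ r₀ :=
    ⟨_, (Nat.lt_pow_self hp.one_lt).le⟩
  refine ⟨m + r₀, ?_⟩
  intro e he Φ hΦc hΦX hΦb Y _ y hy hyΦ
  obtain ⟨r, rfl⟩ : ∃ r, e = r + m := ⟨e - m, by omega⟩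
  set R := p ^ r with hR
  have hRr : p ^ r₀ ≤ R := Nat.pow_le_pow_right hp.pos (by omega)
  have hQ : p ^ (r + m) = R * P := by rw [pow_add]
  rw [hQ] at hyΦ hΦc ⊢
  -- the functions `B`
  have hvU : ∀ l, Module.finrank k ((filt b l).map v.toLinearMap) = h * l := by
    intro l
    rw [← finrank_filt b l]
    exact ((Submodule.equivMapOfInjective v.toLinearMap hv (filt b l)).finrank_eq).symm
  obtain ⟨ν, _, hνcard, B', hB'U, hB'0, hB'ord⟩ : ∃ (ν : Type) (_ : Fintype ν) (_ : Fintype.card ν = h * β)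
      (B' : ν → PowerSeries k), (∀ i, B' i ∈ (filt b β).map v.toLinearMap) ∧ (∀ i, B' i ≠ 0) ∧
      ∀ i j, (B' i).order = (B' j).order → i = j :=
    ⟨_, _, by rw [Fintype.card_fin, hvU], ps_order_many ((filt b β).map v.toLinearMap)⟩
  choose B hBm hB using hB'U
  have hBv : ∀ s, v (B s) = B' s := hB
  let w := Module.finBasis k (filt b a)
  have hΦB : ∀ s, Φ (B s) ∈ filt b (β + c₁) := fun s => by
    refine frob_mem_filt b (iterateFrobenius k p (r + m)) Φ (fun c => ?_) hΦX hΦb (hBm s)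
    rw [hΦc, iterateFrobenius_def, hQ]
  let u : Fin (Module.finrank k (filt b a)) × ν → filt b (P * (a + c) + c + (β + c₁) + c) :=
    fun x => ⟨(w x.1 : S) ^ P * Φ (B x.2),
      hc _ _ _ (pow_mem_filt b h1 hc (w x.1).2 P) _ (hΦB x.2)⟩
  have hdep : ¬ LinearIndependent k u := by
    intro hli
    have := hli.fintype_card_le_finrank
    rw [Fintype.card_prod, Fintype.card_fin, hνcard, finrank_filt, finrank_filt, ← hh] at this
    have h2 : h * (h * a * β) ≤ h * (P * (a + c) + c + (β + c₁) + c) := by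
      calc h * (h * a * β) = h * a * (h * β) := by ring
        _ ≤ _ := this
    exact absurd (Nat.le_of_mul_le_mul_left h2 hpos) (not_le.mpr hcount)
  rw [Fintype.not_linearIndependent_iff] at hdep
  obtain ⟨γ, hγ, ⟨i₀, s₀⟩, hγ0⟩ := hdep
  have hroot : ∀ x, ∃ d : k, d ^ P = γ x := fun x => IsAlgClosed.exists_pow_nat_eq _ hPpos
  choose d hd using hroot
  -- the functions `A`
  let A : ν → filt b a := fun s => ∑ i, d (i, s) • w i
  have hA0 : A s₀ ≠ 0 := by
    intro h0
    have := Fintype.linearIndependent_iff.mp w.linearIndependent (fun i => d (i, s₀)) h0 i₀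
    apply hγ0
    rw [← hd, this, zero_pow hPpos.ne']
  have hApow : ∀ s, (A s : S) ^ P = ∑ i, γ (i, s) • (w i : S) ^ P := by
    intro s
    have : (A s : S) = ∑ i, d (i, s) • (w i : S) := by simp [A]
    rw [this, hP, sum_pow_char_pow]
    refine Finset.sum_congr rfl fun i _ => ?_
    rw [_root_.smul_pow, ← hP, hd]
  have hrel : ∑ s, (A s : S) ^ P * Φ (B s) = 0 := by
    have h2 := congrArg Subtype.val hγ
    simp only [u, Submodule.coe_sum, Submodule.coe_smul, Submodule.coe_zero] at h2
    rw [Fintype.sum_prod_type_right] at h2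
    rw [← h2]
    refine Finset.sum_congr rfl fun s _ => ?_
    rw [hApow, Finset.sum_mul]
    refine Finset.sum_congr rfl fun i _ => ?_
    rw [smul_mul_assoc]
  set g : S := ∑ s, (A s : S) * B s ^ R with hg
  have hyg : ∀ i, y i g = 0 := by
    intro i
    have h2 : (y i g) ^ P = 0 := by
      rw [hg, map_sum, hP, sum_pow_char_pow, ← hP, ← map_zero (y i), ← hrel, map_sum]
      refine Finset.sum_congr rfl fun s _ => ?_
      rw [map_mul, map_mul, hyΦ, map_pow, map_pow, mul_pow, ← pow_mul]
    exact pow_eq_zero_iff hPpos.ne' |>.mp h2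
  have hRN : N < R := by omega
  have hg0 : g ≠ 0 := by
    intro h0
    have h2 : ∑ s, v (A s : S) * (B' s) ^ R = 0 := by
      rw [← map_zero v, ← h0, hg, map_sum]
      refine Finset.sum_congr rfl fun s _ => ?_
      rw [map_mul, map_pow, hBv]
    refine ps_sum_ne_zero Finset.univ (fun s => v (A s : S) * (B' s) ^ R) ?_ ?_ h2
    · intro s _ s' _ hs hs' hord
      have key : ∀ s, v (A s : S) * (B' s) ^ R ≠ 0 → ∃ n ≤ N,
          (v (A s : S) * (B' s) ^ R).order = ((n + R * (B' s).order.toNat : ℕ) : ℕ∞) := by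
        intro s hs
        have hvA : v (A s : S) ≠ 0 := left_ne_zero_of_mul hs
        refine ⟨(v (A s : S)).order.toNat, ?_, ?_⟩
        · have := hN (v (A s : S)) ⟨_, (A s).2, rfl⟩ hvA
          rw [← PowerSeries.coe_toNat_order hvA] at this
          exact_mod_cast this
        · rw [PowerSeries.order_mul, PowerSeries.order_pow, Nat.cast_add, Nat.cast_mul,
            PowerSeries.coe_toNat_order hvA, PowerSeries.coe_toNat_order (hB'0 s), nsmul_eq_mul]
      obtain ⟨n, hn, e1⟩ := key s hs
      obtain ⟨n', hn', e2⟩ := key s' hs'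
      rw [e1, e2] at hord
      have hord' : n + R * (B' s).order.toNat = n' + R * (B' s').order.toNat := by
        exact_mod_cast hord
      apply hB'ord
      rw [← PowerSeries.coe_toNat_order (hB'0 s), ← PowerSeries.coe_toNat_order (hB'0 s')]
      have e3 : (n + R * (B' s).order.toNat) / R = (B' s).order.toNat := by
        rw [Nat.add_mul_div_left _ _ (by omega), Nat.div_eq_of_lt (by omega), zero_add]
      have e4 : (n' + R * (B' s').order.toNat) / R = (B' s').order.toNat := by
        rw [Nat.add_mul_div_left _ _ (by omega), Nat.div_eq_of_lt (by omega), zero_add]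
      rw [← e3, ← e4, hord']
    · refine ⟨s₀, Finset.mem_univ _, mul_ne_zero ?_ (pow_ne_zero _ (hB'0 s₀))⟩
      rw [Ne, map_eq_zero_iff v hv]
      exact fun h => hA0 (Subtype.ext h)
  have hgm : g ∈ filt b (a + (R * (β + c) + c) + c) :=
    Submodule.sum_mem _ fun s _ => hc _ _ _ (A s).2 _ (pow_mem_filt b h1 hc (hBm s) R)
  have hfin := zero_estimate b hc hg0 hgm y hy hyg
  rw [← hh] at hfin
  have h5 : 2 * (M * Fintype.card Y) ≤ 2 * ((M + 1) * (R * P)) := by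
    calc 2 * (M * Fintype.card Y) ≤ 2 * (M * (h * (a + (R * (β + c) + c) + c + c))) := by gcongr
      _ = R * (2 * M * h * β) + R * (2 * M * h * c) + 2 * M * h * (a + 3 * c) := by ring
      _ ≤ R * ((2 * M + 1) * P + 2 * M * h) + R * (2 * M * h * c) + R := by
          gcongr
          omega
      _ = R * ((2 * M + 1) * P + (2 * M * h * (1 + c) + 1)) := by ring
      _ ≤ R * ((2 * M + 1) * P + P) := by
          gcongr
          omega
      _ = _ := by ring
  omega
end Main


theorem ps_hensel {k : Type} [Field k] (f : (PowerSeries k)[X]) (hf : f.Monic) (c : k)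
    (h0 : PowerSeries.constantCoeff (f.eval (PowerSeries.C c)) = 0)
    (h1 : PowerSeries.constantCoeff (f.derivative.eval (PowerSeries.C c)) ≠ 0) :
    ∃ x : PowerSeries k, f.eval x = 0 ∧ PowerSeries.constantCoeff x = c := by
  obtain ⟨x, hx, hxc⟩ := HenselianRing.is_henselian (I := Ideal.span {(PowerSeries.X : PowerSeries k)})
    f hf (PowerSeries.C c)
    (by rw [Ideal.mem_span_singleton, PowerSeries.X_dvd_iff]; exact h0)
    (by
      apply IsUnit.map
      exact PowerSeries.isUnit_iff_constantCoeff.mpr (isUnit_iff_ne_zero.mpr h1))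
  refine ⟨x, hx, ?_⟩
  rw [Ideal.mem_span_singleton, PowerSeries.X_dvd_iff] at hxc
  simpa [sub_eq_zero] using hxc

theorem fpoly_monic {R : Type} [CommRing R] [Nontrivial R] {q : ℕ} (hq : 3 ≤ q) (c : R) :
    (X ^ q + X ^ 2 - C c : R[X]).Monic ∧ (X ^ q + X ^ 2 - C c : R[X]).natDegree = q := by
  have hd : (X ^ 2 - C c : R[X]).degree < (q : ℕ) := by
    rw [degree_X_pow_sub_C (by norm_num)]
    exact_mod_cast hq
  rw [add_sub_assoc]
  refine ⟨monic_X_pow_add hd, ?_⟩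
  rw [natDegree_add_eq_left_of_degree_lt, natDegree_X_pow]
  rwa [degree_X_pow]

theorem fpoly_derivative {R : Type} [CommRing R] {q : ℕ} (hq0 : (q : R) = 0) (c : R) :
    (X ^ q + X ^ 2 - C c : R[X]).derivative = C 2 * X := by
  rw [derivative_sub, derivative_add, derivative_X_pow, derivative_X_pow, derivative_C, hq0]
  simp

/-- a monic polynomial of degree `n` with `n` distinct roots -/
theorem eq_prod_of_roots {R : Type} [CommRing R] [IsDomain R] {J : Type} [Fintype J] (F : R[X])
    (hF : F.Monic) (hd : F.natDegree = Fintype.card J) (x : J → R) (hx : Function.Injective x)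
    (h0 : ∀ j, F.eval (x j) = 0) : F = ∏ j, (X - C (x j)) := by
  classical
  have hle : (Finset.univ.map ⟨x, hx⟩).val ≤ F.roots := by
    rw [Multiset.le_iff_subset (Finset.nodup _)]
    intro r hr
    simp only [Finset.map_val, Multiset.mem_map, Function.Embedding.coeFn_mk] at hr
    obtain ⟨j, _, rfl⟩ := hr
    exact (mem_roots hF.ne_zero).mpr (h0 j)
  have heq : (Finset.univ.map ⟨x, hx⟩).val = F.roots := by
    refine Multiset.eq_of_le_of_card_le hle ?_
    rw [Finset.card_val, Finset.card_map, Finset.card_univ, ← hd]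
    exact card_roots' F
  have h := prod_multiset_X_sub_C_of_monic_of_roots_card_eq hF (by
    rw [← heq, Finset.card_val, Finset.card_map, Finset.card_univ, hd])
  rw [← h, ← heq]
  simp

theorem ps_roots {k : Type} [Field k] [IsAlgClosed k] (q : ℕ) (hq : 3 ≤ q) (hq0 : (q : k) = 0)
    (h2 : (2 : k) ≠ 0) :
    ∃ x : Fin q → PowerSeries k, Function.Injective x ∧
      ((X : (PowerSeries k)[X]) ^ q + X ^ 2 - C (PowerSeries.X ^ 2) = ∏ j, (X - C (x j))) ∧
      ∃ i₀ i₁ : Fin q, i₀ ≠ i₁ ∧ ∀ j, PowerSeries.rescale (-1 : k) (x j) = x (Equiv.swap i₀ i₁ j) := by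
  classical
  have hq0' : (q : PowerSeries k) = 0 := by
    have := congrArg (PowerSeries.C (R := k)) hq0
    simpa using this
  have h2' : PowerSeries.constantCoeff (2 : PowerSeries k) = 2 := map_ofNat _ 2
  set F : (PowerSeries k)[X] := X ^ q + X ^ 2 - C (PowerSeries.X ^ 2) with hF
  have hFm : F.Monic := (fpoly_monic hq _).1
  have hFd : F.natDegree = q := (fpoly_monic hq _).2
  have hFder : F.derivative = C 2 * X := fpoly_derivative hq0' _
  -- big roots
  have hsep : (X ^ (q - 2) - C (-1) : k[X]).Separable := by
    refine separable_X_pow_sub_C _ ?_ (by simp)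
    rw [Nat.cast_sub (by omega), hq0]
    simpa using h2
  set Z : Finset k := (X ^ (q - 2) - C (-1) : k[X]).roots.toFinset with hZ
  have hZcard : Z.card = q - 2 := by
    rw [hZ, Multiset.toFinset_card_of_nodup (nodup_roots hsep),
      ← (IsAlgClosed.splits _).natDegree_eq_card_roots, natDegree_X_pow_sub_C]
  have hZmem : ∀ z ∈ Z, z ^ (q - 2) = -1 ∧ z ≠ 0 := by
    intro z hz
    rw [hZ, Multiset.mem_toFinset, mem_roots (X_pow_sub_C_ne_zero (by omega) _)] at hz
    have h : z ^ (q - 2) = -1 := by simpa [sub_eq_zero, add_eq_zero_iff_eq_neg] using hz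
    refine ⟨h, fun h0 => ?_⟩
    rw [h0, zero_pow (by omega)] at h
    simp at h
  have hbig : ∀ z : Z, ∃ x : PowerSeries k, F.eval x = 0 ∧ PowerSeries.constantCoeff x = z := by
    rintro ⟨z, hz⟩
    obtain ⟨h, h0⟩ := hZmem z hz
    refine ps_hensel F hFm z ?_ ?_
    · have : z ^ q = z ^ (q - 2) * z ^ 2 := by rw [← pow_add]; congr 1; omega
      simp [hF, this, h]
    · rw [hFder]; simp [h2', h2, h0]
  -- small roots
  have hsmall : ∀ ε : k, ε ^ 2 = 1 → ∃ x : PowerSeries k, F.eval x = 0 ∧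
      PowerSeries.constantCoeff x = 0 ∧ PowerSeries.coeff 1 x = ε := by
    intro ε hε
    have hε0 : ε ≠ 0 := by rintro rfl; simp at hε
    have hεq : ε ^ q = ε ^ (q - 2) := by
      have : q = (q - 2) + 2 := by omega
      conv_lhs => rw [this, pow_add, hε, mul_one]
    set G : (PowerSeries k)[X] := X ^ q + (- X ^ (q - 2) - C (PowerSeries.X ^ (q - 2))) with hG
    have hGd : (- X ^ (q - 2) - C (PowerSeries.X ^ (q - 2)) : (PowerSeries k)[X]).degree < q := by
      rw [← neg_add', degree_neg]
      refine lt_of_le_of_lt (degree_add_le _ _) ?_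
      rw [max_lt_iff, degree_X_pow]
      refine ⟨by exact_mod_cast (by omega : q - 2 < q), lt_of_le_of_lt degree_C_le ?_⟩
      exact_mod_cast (by omega : 0 < q)
    have hGm : G.Monic := monic_X_pow_add hGd
    obtain ⟨z, hz, hzc⟩ := ps_hensel G hGm ε (by
        simp [hG, hεq, zero_pow (show q - 2 ≠ 0 by omega)]) (by
        have e : G.derivative = - (C ((q - 2 : ℕ) : PowerSeries k) * X ^ (q - 2 - 1)) := by
          rw [hG, derivative_add, derivative_sub, derivative_neg, derivative_X_pow,
            derivative_X_pow, derivative_C, hq0']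
          simp
        rw [e, Nat.cast_sub (by omega), hq0']
        simp [h2', h2, hε0])
    have hz0 : PowerSeries.constantCoeff z ≠ 0 := by rw [hzc]; exact hε0
    have hzi : z * z⁻¹ = 1 := PowerSeries.mul_inv_cancel z hz0
    have hzq : z ^ q = z ^ (q - 2) + PowerSeries.X ^ (q - 2) := by
      have : z ^ q + (- z ^ (q - 2) - PowerSeries.X ^ (q - 2)) = 0 := by simpa [hG] using hz
      linear_combination this
    refine ⟨PowerSeries.X * z⁻¹, ?_, by simp, ?_⟩
    · have e1 : PowerSeries.X ^ q = (PowerSeries.X ^ (q - 2) : PowerSeries k) * PowerSeries.X ^ 2 := by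
        rw [← pow_add]; congr 1; omega
      have e2 : z ^ q = z ^ (q - 2) * z ^ 2 := by
        rw [← pow_add]; congr 1; omega
      have e3 : (z⁻¹) ^ q = (z⁻¹) ^ (q - 2) * (z⁻¹) ^ 2 := by
        rw [← pow_add]; congr 1; omega
      have e4 : z ^ (q - 2) * (z⁻¹) ^ (q - 2) = 1 := by rw [← mul_pow, hzi, one_pow]
      have e5 : z ^ 2 * (z⁻¹) ^ 2 = 1 := by rw [← mul_pow, hzi, one_pow]
      have e6 : F.eval (PowerSeries.X * z⁻¹) =
          (PowerSeries.X * z⁻¹) ^ q + (PowerSeries.X * z⁻¹) ^ 2 - PowerSeries.X ^ 2 := by simp [hF]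
      rw [e6, mul_pow, mul_pow, e1, e3]
      rw [e2] at hzq
      generalize z ^ (q - 2) = A at *
      generalize (z⁻¹) ^ (q - 2) = B at *
      generalize z⁻¹ = w at *
      generalize (PowerSeries.X : PowerSeries k) ^ (q - 2) = T at *
      generalize (PowerSeries.X : PowerSeries k) = s at *
      linear_combination (-s ^ 2 * B * w ^ 2) * hzq - s ^ 2 * w ^ 2 * e4 + s ^ 2 * (B * A * e5 + e4)
    · rw [mul_comm, show (1 : ℕ) = 0 + 1 from rfl, PowerSeries.coeff_succ_mul_X]
      simp only [PowerSeries.coeff_zero_eq_constantCoeff, PowerSeries.constantCoeff_inv, hzc]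
      exact inv_eq_of_mul_eq_one_left (by rw [← sq, hε])
  choose xb hxb hxbc using hbig
  obtain ⟨xp, hxp, hxp0, hxp1⟩ := hsmall 1 (by norm_num)
  obtain ⟨xm, hxm, hxm0, hxm1⟩ := hsmall (-1) (by norm_num)
  have hpm : xp ≠ xm := by
    rintro rfl
    rw [hxp1] at hxm1
    apply h2
    linear_combination hxm1
  have hb0 : ∀ z, PowerSeries.constantCoeff (xb z) ≠ 0 := fun z => by
    rw [hxbc]; exact (hZmem z z.2).2
  let x' : Option (Option Z) → PowerSeries k
    | none => xp
    | some none => xm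
    | some (some z) => xb z
  have hx'inj : Function.Injective x' := by
    rintro (_ | _ | z) (_ | _ | z') h
    · rfl
    · exact absurd h hpm
    · exact absurd (by rw [← show xp = xb z' from h, hxp0]) (hb0 z')
    · exact absurd h.symm hpm
    · rfl
    · exact absurd (by rw [← show xm = xb z' from h, hxm0]) (hb0 z')
    · exact absurd (by rw [show xb z = xp from h, hxp0]) (hb0 z)
    · exact absurd (by rw [show xb z = xm from h, hxm0]) (hb0 z)
    · have h1 := congrArg PowerSeries.constantCoeff (show xb z = xb z' from h)
      rw [hxbc, hxbc] at h1
      rw [Subtype.ext h1]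
  have hx'0 : ∀ j, F.eval (x' j) = 0 := by
    rintro (_ | _ | z)
    · exact hxp
    · exact hxm
    · exact hxb z
  have hcard : Fintype.card (Option (Option Z)) = q := by
    simp [hZcard]; omega
  have hprod' := eq_prod_of_roots F hFm (by rw [hFd, hcard]) x' hx'inj hx'0
  have hroots : ∀ y, F.eval y = 0 → ∃ j, y = x' j := by
    intro y hy
    rw [hprod', eval_prod, Finset.prod_eq_zero_iff] at hy
    obtain ⟨j, _, hj⟩ := hy
    exact ⟨j, by simpa [sub_eq_zero] using hj⟩
  have hτ : ∀ y, F.eval y = 0 → F.eval (PowerSeries.rescale (-1 : k) y) = 0 := by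
    intro y hy
    have h1 := congrArg (PowerSeries.rescale (-1 : k)) hy
    simp only [hF, eval_sub, eval_add, eval_pow, eval_X, eval_C, map_sub, map_add, map_pow,
      map_zero, PowerSeries.rescale_X] at h1 ⊢
    simpa using h1
  have hτ0 : ∀ y, PowerSeries.constantCoeff (PowerSeries.rescale (-1 : k) y) =
      PowerSeries.constantCoeff y := by
    intro y
    rw [← PowerSeries.coeff_zero_eq_constantCoeff_apply, PowerSeries.coeff_rescale]; simp
  have hτ1 : ∀ y, PowerSeries.coeff 1 (PowerSeries.rescale (-1 : k) y) =
      - PowerSeries.coeff 1 y := by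
    intro y
    rw [PowerSeries.coeff_rescale]; simp
  have h11 : (1 : k) ≠ -1 := fun h => h2 (by linear_combination h)
  have hswap' : ∀ j, PowerSeries.rescale (-1 : k) (x' j) =
      x' (Equiv.swap none (some none) j) := by
    intro j
    obtain ⟨j', hj'⟩ := hroots _ (hτ _ (hx'0 j))
    have c0 := congrArg PowerSeries.constantCoeff hj'
    have c1 := congrArg (PowerSeries.coeff 1) hj'
    rw [hτ0] at c0
    rw [hτ1] at c1
    rw [hj']
    congr 1
    rcases j with (_ | _ | z) <;> rcases j' with (_ | _ | z')
    · exact absurd (show -(PowerSeries.coeff 1 xp) = PowerSeries.coeff 1 xp from c1)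
        (by rw [hxp1]; exact h11.symm)
    · simp
    · exact absurd (show PowerSeries.constantCoeff xp = PowerSeries.constantCoeff (xb z') from c0)
        (by rw [hxp0]; exact (hb0 z').symm)
    · simp
    · exact absurd (show -(PowerSeries.coeff 1 xm) = PowerSeries.coeff 1 xm from c1)
        (by rw [hxm1, neg_neg]; exact h11)
    · exact absurd (show PowerSeries.constantCoeff xm = PowerSeries.constantCoeff (xb z') from c0)
        (by rw [hxm0]; exact (hb0 z').symm)
    · exact absurd (show PowerSeries.constantCoeff (xb z) = PowerSeries.constantCoeff xp from c0)
        (by rw [hxp0]; exact (hb0 z))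
    · exact absurd (show PowerSeries.constantCoeff (xb z) = PowerSeries.constantCoeff xm from c0)
        (by rw [hxm0]; exact (hb0 z))
    · have c2 : PowerSeries.constantCoeff (xb z) = PowerSeries.constantCoeff (xb z') := c0
      rw [hxbc, hxbc] at c2
      rw [Subtype.ext c2, Equiv.swap_apply_of_ne_of_ne] <;> simp
  let e : Fin q ≃ Option (Option Z) := (Fintype.equivFinOfCardEq hcard).symm
  refine ⟨x' ∘ e, hx'inj.comp e.injective, ?_, e.symm none, e.symm (some none), ?_, ?_⟩
  · rw [hprod']
    exact (e.prod_comp (fun j => X - C (x' j))).symm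
  · simp
  · intro j
    simp only [Function.comp_apply]
    rw [hswap']
    congr 1
    simp only [Equiv.swap_apply_def, Equiv.eq_symm_apply]
    split_ifs <;> simp


theorem move_root {k L : Type} [Field k] [Field L] [Algebra k L] {q : ℕ} (x : Fin q → L)
    (hadj : IntermediateField.adjoin k (Set.range x) = ⊤) (f : k[X]) (t : L)
    (hprod : f.map (algebraMap k L) - C t = ∏ j, (X - C (x j)))
    (c : L) (hc : Transcendental k c) (ht : t ∈ IntermediateField.adjoin k {c})
    (P : k[X]) (u u' : L) (hu : aeval u P = c) (hu' : aeval u' P = c) :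
    ∃ h : L ≃ₐ[k] L, h c = c ∧ h u = u' := by
  classical
  have hPne : P ≠ 0 := by
    rintro rfl
    rw [map_zero] at hu
    rw [← hu] at hc
    exact hc isAlgebraic_zero
  have htr : ∀ w, aeval w P = c → Transcendental k w := by
    intro w hw hal
    apply hc
    rw [← hw]
    have hI : IsIntegral k w := IsAlgebraic.isIntegral hal
    have hle : Algebra.adjoin k {w} ≤ integralClosure k L := Algebra.adjoin_le (by
      rintro _ rfl; exact hI)
    exact IsIntegral.isAlgebraic (hle (aeval_mem_adjoin_singleton k w))
  set B := IntermediateField.adjoin k {c} with hB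
  let cB : B := ⟨c, IntermediateField.mem_adjoin_simple_self k c⟩
  let tB : B := ⟨t, ht⟩
  -- normality
  have hn : Normal B L := by
    have : IsSplittingField B L (f.map (algebraMap k B) - C tB) := by
      have e : (f.map (algebraMap k B) - C tB).map (algebraMap B L) = ∏ j, (X - C (x j)) := by
        rw [← hprod, Polynomial.map_sub, Polynomial.map_map, map_C,
          ← IsScalarTower.algebraMap_eq]
        rfl
      rw [isSplittingField_iff_intermediateField]
      constructor
      · rw [e]
        exact Splits.prod fun j _ => Splits.X_sub_C _
      · rw [← IntermediateField.restrictScalars_eq_top_iff (K := k), eq_top_iff, ← hadj,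
          IntermediateField.adjoin_le_iff]
        rintro _ ⟨j, rfl⟩
        apply IntermediateField.subset_adjoin B
        rw [mem_rootSet', e]
        refine ⟨(monic_prod_X_sub_C _ _).ne_zero, ?_⟩
        rw [← eval_map_algebraMap, e, eval_prod]
        exact Finset.prod_eq_zero (Finset.mem_univ j) (by simp)
    exact Normal.of_isSplittingField (f.map (algebraMap k B) - C tB)
  -- the isomorphism
  let e1 := RatFunc.algEquivOfTranscendental u (htr u hu)
  let e2 := RatFunc.algEquivOfTranscendental u' (htr u' hu')
  let U := IntermediateField.adjoin k {u}
  let U' := IntermediateField.adjoin k {u'}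
  let ψ : U →ₐ[k] L := U'.val.comp ((e1.symm.trans e2 : U ≃ₐ[k] U') : U →ₐ[k] U')
  let uU : U := IntermediateField.AdjoinSimple.gen k u
  have hψu : ψ uU = u' := by
    change ((e2 (e1.symm (IntermediateField.AdjoinSimple.gen k u)) : U') : L) = u'
    simp only [e1, e2]
    rw [RatFunc.algEquivOfTranscendental_symm_gen, RatFunc.algEquivOfTranscendental_X]
  have hcU : aeval uU P = (⟨c, by
      rw [← hu]
      exact (IntermediateField.algebra_adjoin_le_adjoin k {u}) (aeval_mem_adjoin_singleton k u)⟩ : U) := by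
    apply Subtype.ext
    have := aeval_algebraMap_apply L uU P
    exact this.symm.trans hu
  have hBU : B ≤ U := by
    rw [hB, IntermediateField.adjoin_simple_le_iff, ← hu]
    exact (IntermediateField.algebra_adjoin_le_adjoin k {u}) (aeval_mem_adjoin_singleton k u)
  have hψB : ψ.comp (IntermediateField.inclusion hBU) = B.val := by
    refine IntermediateField.algHom_ext_of_eq_adjoin _ hB ?_
    intro z hz
    obtain rfl : z = c := hz
    have h1 : IntermediateField.inclusion hBU cB = aeval uU P := by rw [hcU]; rfl
    change ψ (IntermediateField.inclusion hBU cB) = z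
    rw [h1, ← aeval_algHom_apply, hψu, hu']
  have hroot : aeval u' (minpoly B u) = 0 := by
    have h0 : aeval u (minpoly B u) = 0 := minpoly.aeval B u
    have h1 : eval₂ ((IntermediateField.inclusion hBU : B →ₐ[k] U) : B →+* U) uU (minpoly B u) = 0 := by
      apply (algebraMap U L).injective
      rw [hom_eval₂, map_zero, ← h0, aeval_def]
      rfl
    have h2 := congrArg ψ h1
    rw [map_zero] at h2
    have h3 := hom_eval₂ (minpoly B u) ((IntermediateField.inclusion hBU : B →ₐ[k] U) : B →+* U) (ψ : U →+* L) uU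
    rw [aeval_def, ← h2]
    refine Eq.trans ?_ h3.symm
    have h4 : algebraMap B L = (ψ : U →+* L).comp ((IntermediateField.inclusion hBU : B →ₐ[k] U) : B →+* U) := by
      ext z
      exact (congrArg (fun g : B →ₐ[k] L => g z) hψB).symm
    rw [← h4]
    congr 1
    exact hψu.symm
  obtain ⟨σ, hσ⟩ := minpoly.exists_algEquiv_of_root' (hn.isIntegral u).isAlgebraic hroot
  exact ⟨σ.restrictScalars k, σ.commutes cB, hσ⟩


theorem perm_top {n : ℕ} (H : Subgroup (Equiv.Perm (Fin n)))
    (h1 : ∀ i j, ∃ σ ∈ H, σ i = j)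
    (h2 : ∀ j i i', i ≠ j → i' ≠ j → ∃ σ ∈ H, σ j = j ∧ σ i = i')
    (i₀ i₁ : Fin n) (hne : i₀ ≠ i₁) (hs : Equiv.swap i₀ i₁ ∈ H) : H = ⊤ := by
  rw [eq_top_iff, ← Equiv.Perm.closure_isSwap, Subgroup.closure_le]
  rintro _ ⟨a, b, hab, rfl⟩
  obtain ⟨σ, hσ, rfl⟩ := h1 i₀ a
  obtain ⟨τ, hτ, hτ1, rfl⟩ := h2 (σ i₀) (σ i₁) b (fun h => hne (σ.injective h).symm) hab.symm
  have e : Equiv.swap (σ i₀) (τ (σ i₁)) = (τ * σ) * Equiv.swap i₀ i₁ * (τ * σ)⁻¹ := by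
    rw [Equiv.mul_swap_eq_swap_mul, mul_inv_cancel_right, Equiv.Perm.mul_apply,
      Equiv.Perm.mul_apply, hτ1]
  rw [e]
  exact H.mul_mem (H.mul_mem (H.mul_mem hτ hσ) hs) (H.inv_mem (H.mul_mem hτ hσ))

theorem perm_of_aut {k L : Type} [Field k] [Field L] [Algebra k L] {q : ℕ} (x : Fin q → L)
    (hx : Function.Injective x) (f : k[X]) (t : L)
    (hprod : f.map (algebraMap k L) - C t = ∏ j, (X - C (x j))) (g : L ≃ₐ[k] L) (hg : g t = t) :
    ∃ σ : Equiv.Perm (Fin q), ∀ i, g (x i) = x (σ i) := by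
  have hroot : ∀ i, aeval (x i) f = t := by
    intro i
    have h := congrArg (eval (x i)) hprod
    rw [eval_prod, Finset.prod_eq_zero (Finset.mem_univ i) (by simp)] at h
    simpa [sub_eq_zero] using h
  have hex : ∀ i, ∃ j, g (x i) = x j := by
    intro i
    have h := congrArg (eval (g (x i))) hprod
    rw [eval_sub, eval_map_algebraMap, aeval_algHom_apply, hroot, hg, eval_C, sub_self, eval_prod,
      eq_comm, Finset.prod_eq_zero_iff] at h
    obtain ⟨j, _, hj⟩ := h
    exact ⟨j, by simpa [sub_eq_zero] using hj⟩
  choose s hs using hex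
  have hinj : Function.Injective s := by
    intro i j h
    apply hx
    apply g.injective
    rw [hs, hs, h]
  exact ⟨Equiv.ofBijective s (Finite.injective_iff_bijective.mp hinj), hs⟩

theorem all_auts {k L : Type} [Field k] [Field L] [Algebra k L] {p a : ℕ} [Fact p.Prime]
    [CharP k p] (hq : 3 ≤ p ^ a) (h2 : (2 : k) ≠ 0) (x : Fin (p ^ a) → L)
    (hx : Function.Injective x)
    (hadj : IntermediateField.adjoin k (Set.range x) = ⊤) (t : L) (ht : Transcendental k t)
    (hprod : X ^ p ^ a + X ^ 2 - C t = ∏ j, (X - C (x j)))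
    (g₀ : L ≃ₐ[k] L) (i₀ i₁ : Fin (p ^ a)) (hne : i₀ ≠ i₁)
    (hg₀ : ∀ j, g₀ (x j) = x (Equiv.swap i₀ i₁ j)) (σ : Equiv.Perm (Fin (p ^ a))) :
    ∃ g : L ≃ₐ[k] L, ∀ i, g (x i) = x (σ i) := by
  have : CharP L p := charP_of_injective_algebraMap (algebraMap k L).injective p
  set f : k[X] := X ^ p ^ a + X ^ 2 with hf
  have hprod' : f.map (algebraMap k L) - C t = ∏ j, (X - C (x j)) := by
    rw [← hprod]; simp [hf]
  have hroot : ∀ i, aeval (x i) f = t := by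
    intro i
    have h := congrArg (eval (x i)) hprod'
    rw [eval_prod, Finset.prod_eq_zero (Finset.mem_univ i) (by simp)] at h
    simpa [sub_eq_zero] using h
  have hroot' : ∀ i, x i ^ p ^ a + x i ^ 2 = t := by
    intro i; simpa [hf] using hroot i
  let H : Subgroup (Equiv.Perm (Fin (p ^ a))) :=
    { carrier := {σ | ∃ g : L ≃ₐ[k] L, ∀ i, g (x i) = x (σ i)}
      one_mem' := ⟨AlgEquiv.refl, fun i => rfl⟩
      mul_mem' := by
        rintro σ τ ⟨g, hg⟩ ⟨h, hh⟩
        exact ⟨h.trans g, fun i => by simp [hg, hh]⟩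
      inv_mem' := by
        rintro σ ⟨g, hg⟩
        refine ⟨g.symm, fun i => ?_⟩
        rw [AlgEquiv.symm_apply_eq, hg]
        simp }
  suffices hH : H = ⊤ by
    have : σ ∈ H := by rw [hH]; trivial
    exact this
  refine perm_top H ?_ ?_ i₀ i₁ hne ⟨g₀, hg₀⟩
  · intro i j
    obtain ⟨h, hc, hu⟩ := move_root x hadj f t hprod' t ht
      (IntermediateField.mem_adjoin_simple_self k t) f (x i) (x j) (hroot i) (hroot j)
    obtain ⟨s, hs⟩ := perm_of_aut x hx f t hprod' h hc
    exact ⟨s, ⟨h, hs⟩, hx (by rw [← hs, hu])⟩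
  · intro j i i' hi hi'
    have hcx : ∀ c : L, c = algebraMap k L (-2) * x j → x j = algebraMap k L (-2)⁻¹ * c := by
      rintro c rfl
      rw [← mul_assoc, ← map_mul, inv_mul_cancel₀ (by simpa using h2), map_one, one_mul]
    have htj : Transcendental k (x j) := by
      intro hal
      apply ht
      rw [← hroot j]
      have hI : IsIntegral k (x j) := IsAlgebraic.isIntegral hal
      have hle : Algebra.adjoin k {x j} ≤ integralClosure k L := Algebra.adjoin_le (by
        rintro _ rfl; exact hI)
      exact IsIntegral.isAlgebraic (hle (aeval_mem_adjoin_singleton k (x j)))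
    set c : L := algebraMap k L (-2) * x j with hc
    have hct : Transcendental k c := by
      intro hal
      apply htj
      rw [hcx c hc]
      exact (isAlgebraic_algebraMap _).mul hal
    have hxc : x j ∈ IntermediateField.adjoin k {c} := by
      rw [hcx c hc]
      exact mul_mem (IntermediateField.algebraMap_mem _ _)
        (IntermediateField.mem_adjoin_simple_self k c)
    have htc : t ∈ IntermediateField.adjoin k {c} := by
      rw [← hroot' j]
      exact add_mem (pow_mem hxc _) (pow_mem hxc _)
    have hP : ∀ i, i ≠ j → aeval (x i - x j) (X ^ (p ^ a - 1) + X : k[X]) = c := by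
      intro i hi
      have hne : x i - x j ≠ 0 := sub_ne_zero.mpr (fun h => hi (hx h))
      apply mul_right_cancel₀ hne
      have e1 : (x i - x j) ^ p ^ a = x i ^ p ^ a - x j ^ p ^ a := sub_pow_char_pow _ _ _
      have e2 : (x i - x j) ^ (p ^ a - 1) * (x i - x j) = (x i - x j) ^ p ^ a := by
        rw [← pow_succ]; congr 1; omega
      simp only [map_add, map_pow, aeval_X, hc, map_neg, map_ofNat]
      linear_combination e2 + e1 + hroot' i - hroot' j
    obtain ⟨h, hh, hu⟩ := move_root x hadj f t hprod' c hct htc _ (x i - x j) (x i' - x j)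
      (hP i hi) (hP i' hi')
    have hxj : h (x j) = x j := by
      rw [hcx c hc, map_mul, hh, AlgEquiv.commutes]
    have hht : h t = t := by
      rw [← hroot' j]; simp [hxj]
    obtain ⟨s, hs⟩ := perm_of_aut x hx f t hprod' h hht
    refine ⟨s, ⟨h, hs⟩, hx (by rw [← hs, hxj]), hx ?_⟩
    rw [← hs]
    rw [map_sub, hxj] at hu
    exact sub_left_injective hu


theorem ringHom_eq_of_basis {A S B ι : Type} [CommRing A] [CommRing S] [Algebra A S] [CommRing B]
    {n : ℕ} (x : Fin n → S) [Fintype ι] (b : Module.Basis ι A S) (μ : ι → Fin n → ℕ)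
    (hb : ∀ i, b i = ∏ j, x j ^ μ i j) (f g : S →+* B)
    (h1 : f.comp (algebraMap A S) = g.comp (algebraMap A S)) (h2 : ∀ j, f (x j) = g (x j)) :
    f = g := by
  ext z
  have h3 : ∀ c, f (algebraMap A S c) = g (algebraMap A S c) := fun c => congrArg (fun h => h c) h1
  rw [← b.sum_repr z]
  simp only [map_sum, Algebra.smul_def, map_mul, hb, map_prod, map_pow, h2, h3]

theorem inj_of_auts {A S L ι : Type} [CommRing A] [CommRing S] [Algebra A S] [Field L]
    {n : ℕ} (x : Fin n → S) [Fintype ι] (b : Module.Basis ι A S) (μ : ι → Fin n → ℕ)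
    (hcard : Fintype.card ι = n.factorial)
    (hb : ∀ i, b i = ∏ j, x j ^ μ i j)
    (s : Equiv.Perm (Fin n) → S →+* S)
    (hs : ∀ σ, (s σ).comp (algebraMap A S) = algebraMap A S) (hsx : ∀ σ j, s σ (x j) = x (σ j))
    (w : S →+* L) (hw : Function.Injective (w.comp (algebraMap A S)))
    (hwx : Function.Injective fun j => w (x j))
    (hg : ∀ σ : Equiv.Perm (Fin n), ∃ g : L →+* L, (∀ c, g (w (algebraMap A S c)) = w (algebraMap A S c)) ∧
      ∀ j, g (w (x j)) = w (x (σ j))) : Function.Injective w := by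
  classical
  have hs' : ∀ σ c, s σ (algebraMap A S c) = algebraMap A S c := fun σ c =>
    congrArg (fun h => h c) (hs σ)
  let χ : Equiv.Perm (Fin n) → S →* L := fun σ => (w.comp (s σ) : S →+* L)
  have hχ : Function.Injective χ := by
    intro σ τ h
    ext1 j
    apply hwx
    have := congrArg (fun h : S →* L => h (x j)) h
    simpa [χ, hsx] using this
  have hLI : LinearIndependent L (fun σ => (χ σ : S → L)) :=
    (linearIndependent_monoidHom S L).comp χ hχ
  have hsum : ∀ σ z, χ σ z = ∑ i, w (algebraMap A S (b.repr z i)) * χ σ (b i) := by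
    intro σ z
    conv_lhs => rw [← b.sum_repr z]
    simp [χ, Algebra.smul_def, hs']
  have hcard' : Fintype.card ι = Fintype.card (Equiv.Perm (Fin n)) := by
    rw [hcard, Fintype.card_perm, Fintype.card_fin]
  let e : ι ≃ Equiv.Perm (Fin n) := Fintype.equivOfCardEq hcard'
  let M : Matrix (Equiv.Perm (Fin n)) (Equiv.Perm (Fin n)) L :=
    Matrix.of fun σ τ => χ σ (b (e.symm τ))
  have hrows : LinearIndependent L M.row := by
    rw [Fintype.linearIndependent_iff]
    intro c hc
    rw [Fintype.linearIndependent_iff] at hLI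
    apply hLI
    ext z
    have hc' : ∀ i, ∑ σ, c σ * χ σ (b i) = 0 := by
      intro i
      have := congrFun hc (e i)
      simpa [M, Matrix.row] using this
    simp only [Finset.sum_apply, Pi.smul_apply, smul_eq_mul, Pi.zero_apply]
    calc ∑ σ, c σ * χ σ z = ∑ σ, ∑ i, w (algebraMap A S (b.repr z i)) * (c σ * χ σ (b i)) := by
          refine Finset.sum_congr rfl fun σ _ => ?_
          rw [hsum, Finset.mul_sum]
          exact Finset.sum_congr rfl fun i _ => by ring
      _ = 0 := by
          rw [Finset.sum_comm]
          refine Finset.sum_eq_zero fun i _ => ?_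
          rw [← Finset.mul_sum, hc', mul_zero]
  have hU : IsUnit M := Matrix.linearIndependent_rows_iff_isUnit.mp hrows
  have hMinj : Function.Injective M.mulVec := Matrix.mulVec_injective_of_isUnit hU
  rw [injective_iff_map_eq_zero]
  intro r hr
  have hχr : ∀ σ, χ σ r = 0 := by
    intro σ
    obtain ⟨g, hg1, hg2⟩ := hg σ
    have : w.comp (s σ) = g.comp w := by
      refine ringHom_eq_of_basis x b μ hb _ _ ?_ ?_
      · ext c
        simp [hs', hg1]
      · intro j
        simp [hsx, hg2]
    change (w.comp (s σ)) r = 0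
    rw [this, RingHom.comp_apply, hr, map_zero]
  have h0 : (fun τ => w (algebraMap A S (b.repr r (e.symm τ)))) = 0 := by
    apply hMinj
    ext σ
    rw [Matrix.mulVec_zero, Pi.zero_apply, ← hχr σ, hsum, Matrix.mulVec, dotProduct,
      ← e.symm.sum_comp]
    exact Finset.sum_congr rfl fun i _ => by simp [M, mul_comm]
  have h1 : b.repr r = 0 := by
    ext i
    have := congrFun h0 (e i)
    simp only [Equiv.symm_apply_apply, Pi.zero_apply] at this
    exact (injective_iff_map_eq_zero _).mp hw _ this
  simpa using h1


theorem ps_X_sq_inj {k : Type} [Field k] (a : k[X])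
    (h : aeval ((PowerSeries.X : PowerSeries k) ^ 2) a = 0) : a = 0 := by
  have h1 : aeval ((PowerSeries.X : PowerSeries k) ^ 2) a = ((expand k 2 a : k[X]) : PowerSeries k) := by
    have h3 : (aeval ((PowerSeries.X : PowerSeries k) ^ 2) : k[X] →ₐ[k] PowerSeries k) =
        (coeToPowerSeries.algHom k : k[X] →ₐ[k] PowerSeries k).comp (expand k 2) := by
      ext1
      simp [coeToPowerSeries.algHom_apply]
    rw [h3]
    simp [coeToPowerSeries.algHom_apply]
  rw [h1, ← Polynomial.coe_zero, Polynomial.coe_inj] at h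
  exact (expand_eq_zero (by norm_num)).mp h

theorem rescale_equiv {k : Type} [Field k] : ∃ g : FractionRing (PowerSeries k) ≃ₐ[k] FractionRing (PowerSeries k),
    ∀ z : PowerSeries k, g (algebraMap _ _ z) = algebraMap _ _ (PowerSeries.rescale (-1 : k) z) := by
  have hinv : ∀ z : PowerSeries k, PowerSeries.rescale (-1 : k) (PowerSeries.rescale (-1 : k) z) = z := by
    intro z
    ext n
    rw [PowerSeries.coeff_rescale, PowerSeries.coeff_rescale, ← mul_assoc, ← mul_pow]
    simp
  let r : PowerSeries k ≃ₐ[k] PowerSeries k :=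
    AlgEquiv.ofRingEquiv (f := RingEquiv.ofRingHom (PowerSeries.rescale (-1 : k)) (PowerSeries.rescale (-1 : k))
      (RingHom.ext hinv) (RingHom.ext hinv)) (by
        intro c
        ext n
        by_cases hn : n = 0
        · simp [PowerSeries.coeff_C, hn]
        · simp [PowerSeries.coeff_C, hn])
  refine ⟨IsFractionRing.algEquivOfAlgEquiv r, fun z => ?_⟩
  rw [IsFractionRing.algEquivOfAlgEquiv_algebraMap]
  rfl

theorem exists_inj {k : Type} [Field k] [IsAlgClosed k] {p a : ℕ} [Fact p.Prime]
    [CharP k p] (hq : 3 ≤ p ^ a) (h2 : (2 : k) ≠ 0)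
    {S ι : Type} [CommRing S] [Algebra k[X] S] (x : Fin (p ^ a) → S) [Fintype ι]
    (b : Module.Basis ι k[X] S) (μ : ι → Fin (p ^ a) → ℕ)
    (hcard : Fintype.card ι = (p ^ a).factorial)
    (hb : ∀ i, b i = ∏ j, x j ^ μ i j)
    (hprod : (X ^ p ^ a + X ^ 2 - C (X : k[X])).map (algebraMap k[X] S) = ∏ j, (X - C (x j)))
    (huniv : ∀ (B : Type) [CommRing B] (φ : k[X] →+* B) (y : Fin (p ^ a) → B),
        (X ^ p ^ a + X ^ 2 - C (X : k[X])).map φ = ∏ j, (X - C (y j)) →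
        ∃ ψ : S →+* B, ψ.comp (algebraMap k[X] S) = φ ∧ ∀ j, ψ (x j) = y j) :
    ∃ v : S →+* PowerSeries k, Function.Injective v ∧
      ∀ c : k, v (algebraMap k[X] S (C c)) = PowerSeries.C c := by
  have ha : a ≠ 0 := by rintro rfl; simp at hq
  have hq0 : ((p ^ a : ℕ) : k) = 0 := by
    rw [Nat.cast_pow, CharP.cast_eq_zero, zero_pow ha]
  obtain ⟨y, hyinj, hyprod, i₀, i₁, hne, hsw⟩ := ps_roots (k := k) (p ^ a) hq hq0 h2
  let φ : k[X] →+* PowerSeries k :=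
    (aeval ((PowerSeries.X : PowerSeries k) ^ 2) : k[X] →ₐ[k] PowerSeries k)
  have hφX : φ X = PowerSeries.X ^ 2 := aeval_X _
  have hφC : ∀ c, φ (C c) = PowerSeries.C c := fun c => aeval_C _ c
  have hφinj : Function.Injective φ := (injective_iff_map_eq_zero _).mpr fun a h => ps_X_sq_inj a h
  obtain ⟨v, hv1, hv2⟩ := huniv (PowerSeries k) φ y (by
    rw [← hyprod]; simp [hφX])
  have hv1' : ∀ c, v (algebraMap k[X] S c) = φ c := fun c => congrArg (fun h => h c) hv1
  refine ⟨v, ?_, fun c => by rw [hv1', hφC]⟩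
  let E := FractionRing (PowerSeries k)
  have hE : Function.Injective (algebraMap (PowerSeries k) E) := IsFractionRing.injective _ _
  let yE : Fin (p ^ a) → E := fun j => algebraMap _ E (y j)
  let L := IntermediateField.adjoin k (Set.range yE)
  let yL : Fin (p ^ a) → L := fun j => ⟨yE j, IntermediateField.subset_adjoin k _ ⟨j, rfl⟩⟩
  have hyL : Function.Injective yL := fun i j h => hyinj (hE (congrArg Subtype.val h))
  have hadj : IntermediateField.adjoin k (Set.range yL) = ⊤ := by
    apply IntermediateField.lift_injective
    rw [IntermediateField.lift_adjoin, IntermediateField.lift_top, ← Set.range_comp]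
    rfl
  obtain ⟨gE, hgE⟩ := rescale_equiv (k := k)
  have hgy : ∀ j, gE (yE j) = yE (Equiv.swap i₀ i₁ j) := fun j => by
    change gE (algebraMap _ _ (y j)) = _
    rw [hgE, hsw]
  have hLmap : L.map gE.toAlgHom = L := by
    change (IntermediateField.adjoin k (Set.range yE)).map _ = _
    rw [IntermediateField.adjoin_map, ← Set.range_comp]
    have : (gE.toAlgHom ∘ yE) = yE ∘ Equiv.swap i₀ i₁ := by
      ext j; exact hgy j
    rw [this, EquivLike.range_comp]
  let g₀ : L ≃ₐ[k] L := (IntermediateField.intermediateFieldMap gE L).trans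
    (IntermediateField.equivOfEq hLmap)
  have hg₀ : ∀ j, g₀ (yL j) = yL (Equiv.swap i₀ i₁ j) := fun j => Subtype.ext (hgy j)
  have hyEprod : (X ^ p ^ a + X ^ 2 - C (algebraMap (PowerSeries k) E (PowerSeries.X ^ 2)) : E[X]) =
      ∏ j, (X - C (yE j)) := by
    have := congrArg (Polynomial.map (algebraMap (PowerSeries k) E)) hyprod
    simpa [Polynomial.map_prod, yE] using this
  let j₀ : Fin (p ^ a) := i₀
  have hty : algebraMap (PowerSeries k) E (PowerSeries.X ^ 2) = yE j₀ ^ p ^ a + yE j₀ ^ 2 := by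
    have h := congrArg (eval (yE j₀)) hyEprod
    rw [eval_prod, Finset.prod_eq_zero (Finset.mem_univ j₀) (by simp)] at h
    simp only [eval_sub, eval_add, eval_pow, eval_X, eval_C] at h
    exact (sub_eq_zero.mp h).symm
  let t : L := yL j₀ ^ p ^ a + yL j₀ ^ 2
  have htE : (t : E) = algebraMap (PowerSeries k) E (PowerSeries.X ^ 2) := hty.symm
  have hyLprod : X ^ p ^ a + X ^ 2 - C t = ∏ j, (X - C (yL j)) := by
    apply Polynomial.map_injective (algebraMap L E) (algebraMap L E).injective
    rw [Polynomial.map_prod]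
    simp only [Polynomial.map_sub, Polynomial.map_add, Polynomial.map_pow, map_X, map_C]
    refine Eq.trans ?_ hyEprod
    rw [← htE]
    rfl
  have htL : Transcendental k t := by
    rw [transcendental_iff]
    intro P hP
    apply ps_X_sq_inj
    apply hE
    have h1 := congrArg (algebraMap L E) hP
    rw [← aeval_algebraMap_apply] at h1
    rw [← aeval_algebraMap_apply, ← htE, map_zero]
    simpa using h1
  have hauts := all_auts hq h2 yL hyL hadj t htL hyLprod g₀ i₀ i₁ hne hg₀
  let φL : k[X] →+* L := (aeval t : k[X] →ₐ[k] L)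
  have hφLX : φL X = t := aeval_X _
  obtain ⟨w, hw1, hw2⟩ := huniv L φL yL (by rw [← hyLprod]; simp [hφLX])
  have hs : ∀ σ : Equiv.Perm (Fin (p ^ a)), ∃ s : S →+* S,
      s.comp (algebraMap k[X] S) = algebraMap k[X] S ∧ ∀ j, s (x j) = x (σ j) := fun σ =>
    huniv S (algebraMap k[X] S) (x ∘ σ) (by
      rw [hprod]; exact (Equiv.prod_comp σ (fun j => X - C (x j))).symm)
  choose s hs1 hs2 using hs
  have hw1' : ∀ c, w (algebraMap k[X] S c) = φL c := fun c => congrArg (fun h => h c) hw1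
  have hwinj : Function.Injective w := by
    refine inj_of_auts x b μ hcard hb s hs1 hs2 w ?_ ?_ ?_
    · rw [hw1]
      exact transcendental_iff_injective.mp htL
    · intro i j h
      simp only [hw2] at h
      exact hyL h
    · intro σ
      obtain ⟨g, hg⟩ := hauts σ
      refine ⟨(g : L →+* L), fun c => ?_, fun j => ?_⟩
      · rw [hw1']
        change g (aeval t c) = aeval t c
        have hgt : g t = t := by
          have h1 : ∀ j, yL j ^ p ^ a + yL j ^ 2 = t := by
            intro j
            have h := congrArg (eval (yL j)) hyLprod
            rw [eval_prod, Finset.prod_eq_zero (Finset.mem_univ j) (by simp)] at h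
            simp only [eval_sub, eval_add, eval_pow, eval_X, eval_C] at h
            exact sub_eq_zero.mp h
          refine Eq.trans ?_ (h1 (σ j₀))
          simp only [t, map_add, map_pow, hg]
        rw [← aeval_algHom_apply, hgt]
      · rw [hw2, hw2]
        exact hg j
  have hcomp : (algebraMap (PowerSeries k) E).comp v = (algebraMap L E).comp w := by
    refine ringHom_eq_of_basis x b μ hb _ _ ?_ ?_
    · rw [RingHom.comp_assoc, RingHom.comp_assoc, hv1, hw1]
      ext c
      · simp only [RingHom.comp_apply, hφC]
        change _ = algebraMap L E (aeval t (C c))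
        rw [aeval_C]
        rfl
      · simp only [RingHom.comp_apply, hφX, hφLX]
        exact htE.symm
    · intro j
      simp only [RingHom.comp_apply, hv2, hw2]
      rfl
  have : Function.Injective ((algebraMap (PowerSeries k) E).comp v) := by
    rw [hcomp]
    exact (algebraMap L E).injective.comp hwinj
  intro z z' hz
  exact this (congrArg (algebraMap (PowerSeries k) E) hz)


theorem fiber_labeling {k : Type} [Field k] [IsAlgClosed k] {q : ℕ} (hq : 3 ≤ q)
    (hq0 : (q : k) = 0) (h2 : (2 : k) ≠ 0) (t : k) (ht : t ≠ 0) :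
    ∃ y : Fin q → k, Function.Injective y ∧ X ^ q + X ^ 2 - C t = ∏ j, (X - C (y j)) := by
  classical
  obtain ⟨hm, hd⟩ := fpoly_monic (R := k) hq t
  set f : k[X] := X ^ q + X ^ 2 - C t with hf
  have hsep : f.Separable := by
    rw [Separable, isCoprime_iff_aeval_ne_zero_of_isAlgClosed k k]
    intro z
    rw [hf, fpoly_derivative hq0]
    by_cases hz : z = 0
    · left
      simp [hz, ht, zero_pow (show q ≠ 0 by omega)]
    · right
      simp [hz, h2]
  have hcard : Fintype.card f.roots.toFinset = q := by
    rw [Fintype.card_coe, Multiset.toFinset_card_of_nodup (nodup_roots hsep),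
      ← (IsAlgClosed.splits _).natDegree_eq_card_roots, hd]
  let e : Fin q ≃ f.roots.toFinset := (Fintype.equivFinOfCardEq hcard).symm
  have hinj : Function.Injective fun j => (e j : k) := Subtype.val_injective.comp e.injective
  refine ⟨fun j => e j, hinj, eq_prod_of_roots f hm (by simpa using hd) _ hinj ?_⟩
  intro j
  have := (e j).2
  rw [Multiset.mem_toFinset, mem_roots hm.ne_zero] at this
  exact this

theorem frob_perm {k : Type} [Field k] {p e q : ℕ} [Fact p.Prime] [CharP k p]
    (t : k) (ht : t ^ p ^ e = t) (y : Fin q → k) (hy : Function.Injective y)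
    (hprod : X ^ q + X ^ 2 - C t = ∏ j, (X - C (y j))) :
    ∃ σ : Equiv.Perm (Fin q), ∀ j, y j ^ p ^ e = y (σ j) := by
  have hroot : ∀ i, y i ^ q + y i ^ 2 = t := by
    intro i
    have h := congrArg (eval (y i)) hprod
    rw [eval_prod, Finset.prod_eq_zero (Finset.mem_univ i) (by simp)] at h
    simpa [sub_eq_zero] using h
  have hex : ∀ i, ∃ j, y i ^ p ^ e = y j := by
    intro i
    have h := congrArg (eval (y i ^ p ^ e)) hprod
    have h3 := congrArg (iterateFrobenius k p e) (hroot i)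
    simp only [map_add, map_pow, iterateFrobenius_def, ht] at h3
    simp only [eval_sub, eval_add, eval_pow, eval_X, eval_C] at h
    rw [h3, sub_self, eval_prod, eq_comm, Finset.prod_eq_zero_iff] at h
    obtain ⟨j, _, hj⟩ := h
    exact ⟨j, by simpa [sub_eq_zero] using hj⟩
  choose s hs using hex
  have hinj : Function.Injective s := by
    intro i j h
    apply hy
    apply (iterateFrobenius k p e).injective
    rw [iterateFrobenius_def, iterateFrobenius_def, hs, hs, h]
  exact ⟨Equiv.ofBijective s (Finite.injective_iff_bijective.mp hinj), hs⟩

theorem exists_point {k : Type} [Field k] [IsAlgClosed k] {p a : ℕ} [Fact p.Prime]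
    [CharP k p] (hq : 3 ≤ p ^ a) (h2 : (2 : k) ≠ 0) :
    ∃ e₀ : ℕ, ∀ e ≥ e₀, ∀ τ : Equiv.Perm (Fin (p ^ a)), ∃ (t : k) (y : Fin (p ^ a) → k),
      t ^ p ^ e = t ∧ Function.Injective y ∧
      X ^ p ^ a + X ^ 2 - C t = ∏ j, (X - C (y j)) ∧ ∀ j, y j ^ p ^ e = y (τ j) := by
  classical
  have hp : p.Prime := Fact.out
  have ha : a ≠ 0 := by rintro rfl; simp at hq
  have hq0 : ((p ^ a : ℕ) : k) = 0 := by
    rw [Nat.cast_pow, CharP.cast_eq_zero, zero_pow ha]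
  obtain ⟨hm, hd⟩ := fpoly_monic (R := k[X]) hq X
  obtain ⟨S, _, _, x, ι, _, b, μ, hcard, hb, hprod, huniv⟩ := exists_usa (p ^ a) k[X] _ hm hd
  let _ : Algebra k S := ((algebraMap k[X] S).comp C).toAlgebra
  have : IsScalarTower k k[X] S := .of_algebraMap_eq fun _ => rfl
  have hkS : ∀ c : k, algebraMap k S c = algebraMap k[X] S (C c) := fun _ => rfl
  obtain ⟨v₀, hv₀, hv₀C⟩ := exists_inj hq h2 x b μ hcard hb hprod huniv
  let v : S →ₐ[k] PowerSeries k := { v₀ with commutes' := hv₀C }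
  have hv : Function.Injective v := hv₀
  set N := (p ^ a).factorial with hN
  have hNpos : 0 < N := Nat.factorial_pos _
  obtain ⟨c₁, hc₁⟩ := exists_bound_family b
    (fun z : Equiv.Perm (Fin (p ^ a)) × ι => ∏ j, x (z.1 j) ^ μ z.2 j)
  obtain ⟨e₁, he₁⟩ := stepanov (p := p) b v hv (2 * N) c₁ (by omega)
  refine ⟨max e₁ (2 * N), fun e he τ => ?_⟩
  have hee : e₁ ≤ e := le_trans (le_max_left _ _) he
  have heN : 2 * N ≤ e := le_trans (le_max_right _ _) he
  have hQN : 2 * N < p ^ e := lt_of_le_of_lt heN (Nat.lt_pow_self hp.one_lt)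
  -- the set of parameters
  have he0 : e ≠ 0 := by omega
  have hQ0 : ((p ^ e : ℕ) : k) = 0 := by
    rw [Nat.cast_pow, CharP.cast_eq_zero, zero_pow he0]
  have hsep : (X ^ (p ^ e - 1) - C 1 : k[X]).Separable := by
    refine separable_X_pow_sub_C _ ?_ (by simp)
    rw [Nat.cast_sub (by omega), hQ0]
    simp
  obtain ⟨T, hTcard, hT⟩ : ∃ T : Finset k, Fintype.card T = p ^ e - 1 ∧
      ∀ t : T, (t : k) ≠ 0 ∧ (t : k) ^ p ^ e = t := by
    let T : Finset k := (X ^ (p ^ e - 1) - C 1 : k[X]).roots.toFinset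
    have hTcard : Fintype.card T = p ^ e - 1 := by
      rw [Fintype.card_coe, Multiset.toFinset_card_of_nodup (nodup_roots hsep),
        ← (IsAlgClosed.splits _).natDegree_eq_card_roots, natDegree_X_pow_sub_C]
    have hT : ∀ t : T, (t : k) ≠ 0 ∧ (t : k) ^ p ^ e = t := by
      rintro ⟨t, ht⟩
      rw [Multiset.mem_toFinset, mem_roots (X_pow_sub_C_ne_zero (by omega) _)] at ht
      have h : t ^ (p ^ e - 1) = 1 := by simpa [sub_eq_zero] using ht
      have h' : t ^ p ^ e = t ^ (p ^ e - 1) * t := by rw [← pow_succ]; congr 1; omega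
      refine ⟨?_, by rw [h', h, one_mul]⟩
      rintro rfl
      rw [zero_pow (by omega)] at h
      simp at h
    exact ⟨T, hTcard, hT⟩
  have hlab : ∀ t : T, ∃ y : Fin (p ^ a) → k, Function.Injective y ∧
      X ^ p ^ a + X ^ 2 - C (t : k) = ∏ j, (X - C (y j)) := fun t =>
    fiber_labeling hq hq0 h2 (t : k) (hT t).1
  choose y₀ hy₀inj hy₀prod using hlab
  let y : T × Equiv.Perm (Fin (p ^ a)) → Fin (p ^ a) → k := fun z j => y₀ z.1 (z.2 j)
  have hyinj : ∀ z, Function.Injective (y z) := fun z => (hy₀inj z.1).comp z.2.injective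
  have hyprod : ∀ z, X ^ p ^ a + X ^ 2 - C (z.1 : k) = ∏ j, (X - C (y z j)) := fun z => by
    rw [hy₀prod z.1]
    exact (Equiv.prod_comp z.2 (fun j => X - C (y₀ z.1 j))).symm
  have hsex : ∀ z, ∃ σ : Equiv.Perm (Fin (p ^ a)), ∀ j, y z j ^ p ^ e = y z (σ j) := fun z =>
    frob_perm (p := p) (e := e) (z.1 : k) (hT z.1).2 (y z) (hyinj z) (hyprod z)
  choose s hs using hsex
  -- bound for each fibre
  have hbound : ∀ σ, 2 * N * Fintype.card {z // s z = σ} ≤ (2 * N + 1) * p ^ e := by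
    intro σ
    let φ : k[X] →+* S := (algebraMap k[X] S).comp (mapRingHom (iterateFrobenius k p e))
    have hφX : φ X = algebraMap k[X] S X := by simp [φ]
    have hφC : ∀ c, φ (C c) = algebraMap k[X] S (C (c ^ p ^ e)) := by
      intro c; simp [φ, iterateFrobenius_def]
    obtain ⟨Φ, hΦ1, hΦ2⟩ := huniv S φ (x ∘ σ) (by
      have e1 : (X ^ p ^ a + X ^ 2 - C (X : k[X])).map φ =
          (X ^ p ^ a + X ^ 2 - C (X : k[X])).map (algebraMap k[X] S) := by
        simp [hφX]
      rw [e1, hprod]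
      exact (Equiv.prod_comp σ (fun j => X - C (x j))).symm)
    have hΦ1' : ∀ c, Φ (algebraMap k[X] S c) = φ c := fun c => congrArg (fun h => h c) hΦ1
    have hψ : ∀ z : {z // s z = σ}, ∃ ψ : S →ₐ[k] k,
        ψ (algebraMap k[X] S X) = z.1.1 ∧ ∀ j, ψ (x j) = y z.1 j := by
      intro z
      obtain ⟨ψ, hψ1, hψ2⟩ := huniv k (evalRingHom (z.1.1 : k)) (y z.1) (by
        rw [← hyprod]; simp)
      have hψ1' : ∀ c, ψ (algebraMap k[X] S c) = eval (z.1.1 : k) c := fun c =>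
        congrArg (fun h => h c) hψ1
      exact ⟨{ ψ with commutes' := fun c => (hψ1' (C c)).trans (eval_C) },
        (hψ1' X).trans eval_X, hψ2⟩
    choose ψ hψX hψx using hψ
    refine he₁ e hee Φ ?_ ?_ ?_ _ ψ ?_ ?_
    · intro c
      rw [hkS, hkS, hΦ1', hφC]
    · rw [hΦ1', hφX]
    · intro i
      rw [hb, map_prod]
      simp only [map_pow, hΦ2]
      exact hc₁ (σ, i)
    · rintro ⟨⟨t, π⟩, hz⟩ ⟨⟨t', π'⟩, hz'⟩ h
      have h1 : (t : k) = t' := by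
        have := congrArg (fun h : S →ₐ[k] k => h (algebraMap k[X] S X)) h
        simpa [hψX] using this
      obtain rfl : t = t' := Subtype.ext h1
      have h3 : π = π' := by
        ext1 j
        have := congrArg (fun h : S →ₐ[k] k => h (x j)) h
        simp only [hψx, y] at this
        exact hy₀inj t this
      subst h3
      rfl
    · intro z w
      have hcomp : (ψ z : S →+* k).comp Φ = (iterateFrobenius k p e).comp (ψ z : S →+* k) := by
        refine ringHom_eq_of_basis x b μ hb _ _ ?_ ?_
        · rw [RingHom.comp_assoc, hΦ1]
          ext c
          · simp only [RingHom.comp_apply, hφC, ← hkS, iterateFrobenius_def]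
            simp
          · simp only [RingHom.comp_apply, hφX, iterateFrobenius_def]
            simp [hψX, (hT z.1.1).2]
        · intro j
          simp only [RingHom.comp_apply, hΦ2, iterateFrobenius_def, Function.comp_apply,
            RingHom.coe_coe, hψx]
          rw [hs, z.2]
      have := congrArg (fun h : S →+* k => h w) hcomp
      simpa [iterateFrobenius_def] using this
  -- counting
  by_contra hcon
  have hempty : ∀ z, s z ≠ τ := by
    intro z hz
    refine hcon ⟨z.1, y z, (hT z.1).2, hyinj z, hyprod z, fun j => ?_⟩
    rw [hs, hz]
  have hsum : ∑ σ, Fintype.card {z // s z = σ} = (p ^ e - 1) * N := by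
    rw [← Fintype.card_sigma, Fintype.card_congr (Equiv.sigmaFiberEquiv s), Fintype.card_prod,
      hTcard, Fintype.card_perm, Fintype.card_fin]
  have hτ0 : Fintype.card {z // s z = τ} = 0 := by
    rw [Fintype.card_eq_zero_iff]
    exact ⟨fun z => hempty z.1 z.2⟩
  have hle : 2 * N * ((p ^ e - 1) * N) ≤ (N - 1) * ((2 * N + 1) * p ^ e) := by
    rw [← hsum, ← Finset.add_sum_erase _ _ (Finset.mem_univ τ), hτ0, zero_add, Finset.mul_sum]
    refine (Finset.sum_le_card_nsmul _ _ _ fun σ _ => hbound σ).trans (le_of_eq ?_)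
    rw [Finset.card_erase_of_mem (Finset.mem_univ _), Finset.card_univ, Fintype.card_perm,
      Fintype.card_fin, smul_eq_mul]
  obtain ⟨n, hn⟩ : ∃ n, N = n + 1 := ⟨N - 1, by omega⟩
  obtain ⟨r, hr⟩ : ∃ r, p ^ e = 2 * N + 1 + r := ⟨p ^ e - (2 * N + 1), by omega⟩
  rw [hr, hn, show n + 1 - 1 = n by omega, show 2 * (n + 1) + 1 + r - 1 = 2 * (n + 1) + r by omega] at hle
  nlinarith


theorem mem_range_of_pow_card {K k : Type} [Field K] [Fintype K] [Field k] [Algebra K k]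
    (t : k) (ht : t ^ Fintype.card K = t) : ∃ c : K, algebraMap K k c = t := by
  classical
  have hc : 1 < Fintype.card K := Fintype.one_lt_card
  have h0 : (X ^ Fintype.card K - X : k[X]) ≠ 0 := FiniteField.X_pow_card_sub_X_ne_zero k hc
  have hd : (X ^ Fintype.card K - X : k[X]).natDegree = Fintype.card K :=
    FiniteField.X_pow_card_sub_X_natDegree_eq k hc
  set I : Finset k := Finset.univ.map ⟨algebraMap K k, (algebraMap K k).injective⟩ with hI
  have hsub : I ⊆ (X ^ Fintype.card K - X : k[X]).roots.toFinset := by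
    intro z hz
    obtain ⟨c, _, rfl⟩ := Finset.mem_map.mp hz
    rw [Multiset.mem_toFinset, mem_roots h0]
    simp [← map_pow, FiniteField.pow_card]
  have heq := Finset.eq_of_subset_of_card_le hsub (by
    rw [hI, Finset.card_map, Finset.card_univ]
    exact ((Multiset.toFinset_card_le _).trans (card_roots' _)).trans (le_of_eq hd))
  have htm : t ∈ I := by
    rw [heq, Multiset.mem_toFinset, mem_roots h0]
    simp [ht]
  obtain ⟨c, _, hc⟩ := Finset.mem_map.mp htm
  exact ⟨c, hc⟩

theorem cycle_factor {K k : Type} [Field K] [Fintype K] [Field k] [Algebra K k] {q : ℕ}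
    (f : K[X]) (hf : f.Monic) (y : Fin q → k) (hy : Function.Injective y) (ℓ : ℕ) (hℓ : 0 < ℓ) (hℓq : ℓ ≤ q)
    (h0 : ∀ j, aeval (y j) f = 0)
    (hfr : ∀ j, y j ^ Fintype.card K = y ((⟨ℓ - 1, by omega⟩ : Fin q).cycleRange j)) :
    ∃ g : K[X], Irreducible g ∧ g.natDegree = ℓ ∧ g ∣ f := by
  classical
  have hq : 0 < q := by omega
  have : NeZero q := ⟨by omega⟩
  let z : k := y ⟨0, hq⟩
  have hint : IsIntegral K z := ⟨f, hf, h0 _⟩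
  have hirr := minpoly.irreducible hint
  have hit : ∀ i (hi : i < ℓ), z ^ Fintype.card K ^ i = y ⟨i, by omega⟩ := by
    intro i
    induction i with
    | zero => intro _; simp [z]
    | succ i ih =>
      intro hi
      rw [pow_succ, pow_mul, ih (by omega), hfr]
      congr 1
      apply Fin.ext
      rw [Fin.coe_cycleRange_of_lt]
      rw [Fin.lt_def]
      change i < ℓ - 1
      omega
  have hend : z ^ Fintype.card K ^ ℓ = z := by
    obtain ⟨m, rfl⟩ : ∃ m, ℓ = m + 1 := ⟨ℓ - 1, by omega⟩
    rw [pow_succ, pow_mul, hit m (by omega), hfr]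
    change y _ = y _
    congr 1
    exact Fin.cycleRange_self _
  refine ⟨minpoly K z, hirr, ?_, minpoly.dvd K z (h0 _)⟩
  apply le_antisymm
  · refine Nat.le_of_dvd hℓ (hirr.natDegree_dvd_of_dvd_X_pow_card_pow_sub_X (minpoly.dvd K z ?_))
    simp [hend]
  · have hroots : ∀ i : Fin ℓ, aeval (y ⟨i, by omega⟩) (minpoly K z) = 0 := by
      intro i
      rw [← hit i i.2]
      have : ∀ i : ℕ, aeval (z ^ Fintype.card K ^ i) (minpoly K z) = 0 := by
        intro i
        induction i with
        | zero => simp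
        | succ i ih =>
          rw [pow_succ, pow_mul, ← expand_aeval, FiniteField.expand_card, map_pow, ih,
            zero_pow Fintype.card_ne_zero]
      exact this i
    have hne : (minpoly K z).map (algebraMap K k) ≠ 0 :=
      Polynomial.map_ne_zero (minpoly.ne_zero hint)
    have hcard : (Finset.univ.image fun i : Fin ℓ => y ⟨i, by omega⟩).card = ℓ := by
      rw [Finset.card_image_of_injective, Finset.card_univ, Fintype.card_fin]
      intro i j h
      have := hy h
      simpa [Fin.ext_iff] using this
    rw [← natDegree_map (algebraMap K k)]
    refine le_trans (le_of_eq hcard.symm) (card_le_degree_of_subset_roots ?_)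
    intro w hw
    rw [Finset.mem_val, Finset.mem_image] at hw
    obtain ⟨i, _, rfl⟩ := hw
    rw [mem_roots hne, IsRoot, eval_map_algebraMap]
    exact hroots i

theorem stmt_7 (p a : ℕ) [Fact p.Prime] (hodd : Odd p) (ha : 0 < a)
    (F : Type) [Field F] [Fintype F] (hF : Fintype.card F = p ^ a) :
    ∃ d₀ : ℕ, 0 < d₀ ∧ ∀ d : ℕ, d₀ < d →
      IsDUniversal ((X : Polynomial F) ^ p ^ a + X ^ 2) d := by
  have hp : p.Prime := Fact.out
  have hFp : CharP F p := by
    have := Nat.card_eq_fintype_card (α := F)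
    obtain ⟨r, hr⟩ := CharP.exists F
    obtain ⟨n, hrp, hn⟩ := FiniteField.card F r
    have h1 : p ∣ r ^ (n : ℕ) := by
      rw [← hn, hF]; exact dvd_pow_self p ha.ne'
    have h2 : p = r := (Nat.prime_dvd_prime_iff_eq hp hrp).mp (hp.dvd_of_dvd_pow h1)
    rw [h2]; exact hr
  let k := AlgebraicClosure F
  have hkp : CharP k p := charP_of_injective_algebraMap (algebraMap F k).injective p
  have hp2 : p ≠ 2 := by
    rintro rfl
    exact absurd hodd (by decide)
  have hp3 : 3 ≤ p := by
    have := hp.two_le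
    omega
  have h2 : (2 : k) ≠ 0 := by
    intro h
    have h' : ((2 : ℕ) : k) = 0 := by exact_mod_cast h
    rw [CharP.cast_eq_zero_iff k p] at h'
    exact hp2 ((Nat.prime_dvd_prime_iff_eq hp Nat.prime_two).mp h')
  have hq : 3 ≤ p ^ a := hp3.trans (Nat.le_self_pow ha.ne' p)
  obtain ⟨e₀, he₀⟩ := exists_point (k := k) hq h2
  refine ⟨e₀ + 1, by omega, fun d hd K _ _ _ hK ℓ hℓ hℓq => ?_⟩
  have hdeg : ((X : F[X]) ^ p ^ a + X ^ 2).natDegree = p ^ a := by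
    have := (fpoly_monic (R := F) hq 0).2
    simpa using this
  rw [hdeg] at hℓq
  have hKQ : Fintype.card K = p ^ (a * d) := by rw [hK, hF, ← pow_mul]
  let i : K →ₐ[F] k := IsAlgClosed.lift
  let _ : Algebra K k := (i : K →+* k).toAlgebra
  have hade : e₀ ≤ a * d := by nlinarith
  obtain ⟨t, y, ht, hy, hprod, hfr⟩ := he₀ (a * d) hade (⟨ℓ - 1, by omega⟩ : Fin (p ^ a)).cycleRange
  rw [← hKQ] at ht hfr
  obtain ⟨t₀, ht₀⟩ := mem_range_of_pow_card (K := K) t ht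
  have hmap : ((X : F[X]) ^ p ^ a + X ^ 2).map (algebraMap F K) = X ^ p ^ a + X ^ 2 := by simp
  rw [hmap] at *
  obtain ⟨g, hg⟩ := cycle_factor (K := K) (k := k) (X ^ p ^ a + X ^ 2 - C t₀)
    (fpoly_monic hq t₀).1 y hy ℓ hℓ hℓq (by
      intro j
      have h := congrArg (eval (y j)) hprod
      rw [eval_prod, Finset.prod_eq_zero (Finset.mem_univ j) (by simp)] at h
      simpa [ht₀] using h) hfr
  exact ⟨t₀, g, hg⟩
end

section
/- Let n ≥ 8 and let G be a subgroup of the symmetric group S_n acting on a set of n elements. Suppose that G contains: (1) a cycle of prime order r with n/2 < r ≤ n − 3; (2) a cycle of length n; and (3) a cycle of length n − 1. Then G is the full symmetric group S_n. -/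
open scoped Pointwise in
open MulAction Equiv Equiv.Perm in
/-- Transitivity on tuples and Sylow: realize any permutation `τ` on the complement of the
support of `σ` by an element of `G` normalizing `⟨σ⟩`. -/
theorem aux_norm {U : Type} [Fintype U] [DecidableEq U] (G : Subgroup (Equiv.Perm U))
    (r : ℕ) (hr : r.Prime) (σ : Equiv.Perm U) (hσ : σ ∈ G) (hc : σ.IsCycle)
    (hs : σ.support.card = r)
    (ht : IsMultiplyPretransitive G U (σ.supportᶜ).card) (τ : Equiv.Perm U) :
    ∃ g ∈ G, (∀ x ∉ σ.support, g x = τ x) ∧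
      ((∀ x ∉ σ.support, τ x ∉ σ.support) → ∃ k : ℕ, g * σ * g⁻¹ = σ ^ k) := by
  classical
  have hσo : orderOf σ = r := by rw [hc.orderOf, hs]
  have : Fact r.Prime := ⟨hr⟩
  let e := (σ.supportᶜ).equivFin
  let x : Fin (σ.supportᶜ).card ↪ U := e.symm.toEmbedding.trans (Function.Embedding.subtype _)
  let y : Fin (σ.supportᶜ).card ↪ U := x.trans τ.toEmbedding
  obtain ⟨⟨g, hg⟩, hgxy⟩ := ht.exists_smul_eq x y
  have hgτ : ∀ z ∉ σ.support, g z = τ z := by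
    intro z hz
    have h1 := DFunLike.congr_fun hgxy (e ⟨z, by simpa using hz⟩)
    simpa [x, y, Function.Embedding.smul_apply, Subgroup.smul_def] using h1
  by_cases hτ : ∀ x ∉ σ.support, τ x ∉ σ.support
  swap
  · exact ⟨g, hg, hgτ, fun h => absurd h hτ⟩
  let F : Subgroup (Perm U) :=
    (Equiv.Perm.ofSubtype : Perm {x // x ∈ σ.support} →* Perm U).range
  have hF : ∀ f : Perm U, f ∈ F ↔ ∀ x ∉ σ.support, f x = x := by
    intro f
    constructor
    · rintro ⟨f', rfl⟩ x hx
      exact Equiv.Perm.ofSubtype_apply_of_not_mem f' hx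
    · intro h
      have h2 : ∀ x, x ∈ σ.support ↔ f x ∈ σ.support := by
        intro x
        constructor
        · intro hx
          by_contra hfx
          have := f.injective (h _ hfx)
          rw [this] at hfx
          exact hfx hx
        · intro hx
          by_contra hfx
          rw [h _ hfx] at hx
          exact hfx hx
      refine ⟨f.subtypePerm (fun x => (h2 x).symm), Equiv.Perm.ofSubtype_subtypePerm _ ?_⟩
      intro x hx
      by_contra hxs
      exact hx (h x hxs)
  have hFc : Nat.card F = r.factorial := by
    rw [← Nat.card_congr (MonoidHom.ofInjective Equiv.Perm.ofSubtype_injective).toEquiv,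
      Nat.card_perm, Nat.card_eq_fintype_card, Fintype.card_coe, hs]
  let K : Subgroup (Perm U) := G ⊓ F
  have hKc : Nat.card K ∣ r.factorial := hFc ▸ Subgroup.card_dvd_of_le inf_le_right
  have hσK : σ ∈ K := ⟨hσ, (hF σ).2 (fun x hx => by simpa using hx)⟩
  have hσ'K : g * σ * g⁻¹ ∈ K := by
    refine ⟨G.mul_mem (G.mul_mem hg hσ) (G.inv_mem hg), (hF _).2 ?_⟩
    intro x hx
    have hinj : Function.Surjective
        (fun z : {z // z ∉ σ.support} => (⟨τ z, hτ z z.2⟩ : {z // z ∉ σ.support})) := by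
      apply Finite.surjective_of_injective
      intro a b hab
      simpa [Subtype.ext_iff] using hab
    obtain ⟨⟨z, hz⟩, hzx⟩ := hinj ⟨x, hx⟩
    have hzx' : g z = x := by rw [hgτ z hz]; exact congrArg Subtype.val hzx
    have : g⁻¹ x = z := by rw [← hzx']; simp
    rw [Perm.mul_apply, Perm.mul_apply, this, Equiv.Perm.notMem_support.1 hz, hzx']
  have hfac : (Nat.card K).factorization r = 1 := by
    apply le_antisymm
    · have h1 := (Nat.factorization_le_iff_dvd Nat.card_pos.ne' (Nat.factorial_ne_zero r)).2 hKc r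
      have h2 : r.factorial.factorization r = 1 := by
        obtain ⟨m, rfl⟩ : ∃ m, r = m + 1 := ⟨r - 1, by have := hr.pos; omega⟩
        rw [Nat.factorial_succ, Nat.factorization_mul (by omega) (Nat.factorial_ne_zero m)]
        simp only [Finsupp.add_apply, hr.factorization_self]
        rw [Nat.factorization_eq_zero_of_not_dvd]
        intro h
        have := (hr.dvd_factorial).1 h
        omega
      omega
    · apply (hr.dvd_iff_one_le_factorization Nat.card_pos.ne').1
      rw [← hσo, ← Subgroup.orderOf_mk σ hσK]
      exact orderOf_dvd_natCard _
  have hor : ∀ s : K, orderOf s = r → Nat.card (Subgroup.zpowers s) =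
      r ^ (Nat.card K).factorization r := by
    intro s h
    rw [hfac, Nat.card_zpowers, h, pow_one]
  let s1 : K := ⟨σ, hσK⟩
  let s2 : K := ⟨g * σ * g⁻¹, hσ'K⟩
  have ho1 : orderOf s1 = r := by simpa [s1] using hσo
  have ho2 : orderOf s2 = r := by
    have : orderOf (g * σ * g⁻¹) = orderOf σ := by
      have := orderOf_injective (MulAut.conj g).toMonoidHom (MulAut.conj g).injective σ
      simpa using this
    simpa [s2, this] using hσo
  let P1 : Sylow r K := Sylow.ofCard _ (hor s1 ho1)
  let P2 : Sylow r K := Sylow.ofCard _ (hor s2 ho2)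
  obtain ⟨h, hh⟩ := MulAction.exists_smul_eq K P2 P1
  have hmem : h * s2 * h⁻¹ ∈ Subgroup.zpowers s1 := by
    have h1 : h * s2 * h⁻¹ ∈ (h • P2 : Sylow r K) := by
      have : s2 ∈ (P2 : Subgroup K) := Subgroup.mem_zpowers s2
      have := Subgroup.smul_mem_pointwise_smul s2 (MulAut.conj h) _ this
      have h3 : h * s2 * h⁻¹ ∈ MulAut.conj h • (P2 : Subgroup K) := by simpa using this
      exact h3
    rw [hh] at h1
    exact h1
  have hmem' : h * s2 * h⁻¹ ∈ Submonoid.powers s1 := by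
    rwa [mem_powers_iff_mem_zpowers]
  obtain ⟨k, hk⟩ := hmem'
  refine ⟨h * g, G.mul_mem h.2.1 hg, ?_, fun _ => ⟨k, ?_⟩⟩
  · intro x hx
    rw [Perm.mul_apply, hgτ x hx]
    exact (hF _).1 h.2.2 _ (hτ x hx)
  · have := congrArg Subtype.val hk
    simp only [s1, s2, Subgroup.coe_pow, Subgroup.coe_mul, Subgroup.coe_inv] at this
    rw [this]
    group

open MulAction Equiv Equiv.Perm in
theorem aux_jordan {U : Type} [Fintype U] [DecidableEq U] (G : Subgroup (Equiv.Perm U))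
    (hG : IsPreprimitive G U)
    (r : ℕ) (hr : r.Prime) (hr2 : r + 3 ≤ Fintype.card U)
    (σ : Equiv.Perm U) (hσ : σ ∈ G) (hc : σ.IsCycle)
    (hs : σ.support.card = r) : alternatingGroup U ≤ G := by
  classical
  have hcard : (σ.supportᶜ).card = Fintype.card U - r := by rw [Finset.card_compl, hs]
  have ht : IsMultiplyPretransitive G U (σ.supportᶜ).card := by
    have h1 : IsMultiplyPreprimitive G U ((σ.supportᶜ).card - 1 + 2) := by
      apply hG.isMultiplyPreprimitive (s := (σ.support : Set U)ᶜ)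
      · rw [← Finset.coe_compl, Set.ncard_coe_finset]; omega
      · rw [Nat.card_eq_fintype_card]; have := hr.two_le; omega
      · have := isPretransitive_of_isCycle_mem hc hσ
        apply IsPreprimitive.of_prime_card
        convert! hr
        rw [Nat.card_eq_fintype_card, Fintype.card_subtype, ← hs]
        apply congr_arg
        ext x
        simp [SubMulAction.mem_ofFixingSubgroup_iff]
    have h2 := h1.isMultiplyPretransitive
    apply MulAction.isMultiplyPretransitive_of_le' (n := (σ.supportᶜ).card - 1 + 2) (by omega)
    rw [ENat.card_eq_coe_fintype_card]
    have := hr.two_le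
    exact_mod_cast (by omega : (σ.supportᶜ).card - 1 + 2 ≤ Fintype.card U)
  obtain ⟨a, b, c, ha, hb, hc', hab, hac, hbc⟩ :=
    Finset.two_lt_card_iff.1 (by omega : 2 < (σ.supportᶜ).card)
  rw [Finset.mem_compl] at ha hb hc'
  have hsw : ∀ u v, u ∉ σ.support → v ∉ σ.support → ∀ x ∉ σ.support,
      swap u v x ∉ σ.support := by
    intro u v hu hv x hx
    rw [swap_apply_def]
    split_ifs <;> assumption
  obtain ⟨g1, hg1, e1, k1⟩ := aux_norm G r hr σ hσ hc hs ht (swap a b)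
  obtain ⟨g2, hg2, e2, k2⟩ := aux_norm G r hr σ hσ hc hs ht (swap a c)
  obtain ⟨k1, hk1⟩ := k1 (hsw a b ha hb)
  obtain ⟨k2, hk2⟩ := k2 (hsw a c ha hc')
  have hcomm : Commute (g1⁻¹ * g2⁻¹ * g1 * g2) σ := by
    have p1 : ∀ m : ℕ, g1 * σ ^ m * g1⁻¹ = σ ^ (k1 * m) := by
      intro m; rw [← conj_pow, hk1, pow_mul]
    have p2 : ∀ m : ℕ, g2 * σ ^ m * g2⁻¹ = σ ^ (k2 * m) := by
      intro m; rw [← conj_pow, hk2, pow_mul]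
    have q : (g1 * g2) * σ * (g1 * g2)⁻¹ = (g2 * g1) * σ * (g2 * g1)⁻¹ := by
      calc _ = g1 * (g2 * σ * g2⁻¹) * g1⁻¹ := by group
        _ = g2 * (g1 * σ * g1⁻¹) * g2⁻¹ := by
          rw [hk1, hk2, p1, p2, mul_comm]
        _ = _ := by group
    have q2 : (g2 * g1)⁻¹ * (g1 * g2) * σ = σ * ((g2 * g1)⁻¹ * (g1 * g2)) := by
      calc _ = (g2 * g1)⁻¹ * ((g1 * g2) * σ * (g1 * g2)⁻¹) * (g1 * g2) := by group
        _ = _ := by rw [q]; group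
    have q3 : g1⁻¹ * g2⁻¹ * g1 * g2 = (g2 * g1)⁻¹ * (g1 * g2) := by group
    rw [q3]
    exact q2
  have i1 : ∀ x ∉ σ.support, g1⁻¹ x = swap a b x := by
    intro x hx
    rw [Perm.inv_eq_iff_eq, e1 _ (hsw a b ha hb x hx), swap_apply_self]
  have i2 : ∀ x ∉ σ.support, g2⁻¹ x = swap a c x := by
    intro x hx
    rw [Perm.inv_eq_iff_eq, e2 _ (hsw a c ha hc' x hx), swap_apply_self]
  set h : Perm U := g1⁻¹ * g2⁻¹ * g1 * g2 with hh
  have hhG : h ∈ G := G.mul_mem (G.mul_mem (G.mul_mem (G.inv_mem hg1) (G.inv_mem hg2)) hg1) hg2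
  have hhx : ∀ x ∉ σ.support, h x = (swap a b * swap a c * swap a b * swap a c) x := by
    intro x hx
    have A := hsw a c ha hc' x hx
    have B := hsw a b ha hb _ A
    have C := hsw a c ha hc' _ B
    simp only [hh, Perm.mul_apply]
    rw [e2 _ hx, e1 _ A, i2 _ B, i1 _ C]
  have h3 : IsThreeCycle (swap a b * swap a c) := isThreeCycle_swap_mul_swap_same hab hac hbc
  have h4 : IsThreeCycle (swap a b * swap a c * swap a b * swap a c) := by
    have := h3.isThreeCycle_sq
    rwa [← mul_assoc] at this
  set t := swap a b * swap a c * swap a b * swap a c with htdef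
  obtain ⟨u, hu, hu2⟩ := id hc
  have hhu : σ (h u) ≠ h u := by
    have h1 : σ (h u) = h (σ u) := by
      rw [← Perm.mul_apply, ← Perm.mul_apply, hcomm.eq]
    rw [h1]
    exact fun h2 => hu (h.injective h2)
  obtain ⟨i, hi⟩ := hu2 hhu
  have htx : ∀ x ∈ σ.support, t x = x := by
    intro x hx
    have hxa : x ≠ a := fun h => ha (h ▸ hx)
    have hxb : x ≠ b := fun h => hb (h ▸ hx)
    have hxc : x ≠ c := fun h => hc' (h ▸ hx)
    simp [htdef, Perm.mul_apply, swap_apply_of_ne_of_ne, hxa, hxb, hxc]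
  clear_value h t
  have hfin : h = σ ^ i * t := by
    ext x
    by_cases hx : x ∈ σ.support
    · rw [Perm.mul_apply, htx x hx]
      obtain ⟨j, rfl⟩ := hu2 (Perm.mem_support.1 hx)
      have := (hcomm.zpow_right j).eq
      rw [← Perm.mul_apply, this, Perm.mul_apply, ← hi, ← Perm.mul_apply, ← Perm.mul_apply,
        ← zpow_add, ← zpow_add, add_comm]
    · rw [Perm.mul_apply, hhx x hx]
      symm
      apply Perm.zpow_apply_eq_self_of_apply_eq_self
      apply Perm.notMem_support.1
      simp only [htdef, Perm.mul_apply]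
      exact hsw a b ha hb _ (hsw a c ha hc' _ (hsw a b ha hb _ (hsw a c ha hc' _ hx)))
  have htG : t ∈ G := by
    have : t = (σ ^ i)⁻¹ * h := by rw [hfin]; group
    rw [this]
    exact G.mul_mem (G.inv_mem (G.zpow_mem hσ i)) hhG
  exact alternatingGroup_le_of_isPreprimitive_of_isThreeCycle_mem hG h4 htG

open MulAction Equiv Equiv.Perm in
theorem aux_prim {U : Type} [Fintype U] [DecidableEq U] (G : Subgroup (Equiv.Perm U))
    (hn : 8 ≤ Fintype.card U)
    (hc2 : ∃ σ : Equiv.Perm U, σ ∈ G ∧ σ.IsCycle ∧ σ.support.card = Fintype.card U)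
    (hc3 : ∃ σ : Equiv.Perm U, σ ∈ G ∧ σ.IsCycle ∧ σ.support.card = Fintype.card U - 1) :
    IsPreprimitive G U := by
  classical
  obtain ⟨σ, hσ, hσc, hσs⟩ := hc2
  obtain ⟨ρ, hρ, hρc, hρs⟩ := hc3
  have hσu : σ.support = Finset.univ := (Finset.card_eq_iff_eq_univ _).1 hσs
  have htr : IsPretransitive G U := by
    refine ⟨fun x y => ?_⟩
    have hx : x ∈ σ.support := hσu ▸ Finset.mem_univ x
    have hy : y ∈ σ.support := hσu ▸ Finset.mem_univ y
    obtain ⟨i, hi⟩ := hσc.exists_zpow_eq (Perm.mem_support.1 hx) (Perm.mem_support.1 hy)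
    exact ⟨⟨σ ^ i, G.zpow_mem hσ i⟩, hi⟩
  have h1 : (ρ.supportᶜ).card = 1 := by rw [Finset.card_compl, hρs]; omega
  obtain ⟨a, ha⟩ := Finset.card_eq_one.1 h1
  have hset : ((ρ.support : Set U)ᶜ) = {a} := by
    rw [← Finset.coe_compl, ha, Finset.coe_singleton]
  have h2 := isPretransitive_of_isCycle_mem hρc hρ
  rw [hset] at h2
  apply isPreprimitive_of_is_two_pretransitive
  rw [SubMulAction.ofStabilizer.isMultiplyPretransitive (a := a), is_one_pretransitive_iff]
  exact IsPretransitive.of_surjective_map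
      SubMulAction.ofFixingSubgroup_of_singleton_bijective.surjective h2


/-- **Group-theoretic step in Theorem 3.1.** Let `n ≥ 8` and let `G ≤ S_n` (acting on a
set `U` of `n` elements) contain a cycle of prime length `r` with `n/2 < r ≤ n - 3`, an
`n`-cycle, and an `(n-1)`-cycle. Then `G = S_n`. -/
theorem stmt_13 (n r : ℕ) (hn : 8 ≤ n)
    (U : Type) [Fintype U] [DecidableEq U] (hU : Fintype.card U = n)
    (G : Subgroup (Equiv.Perm U))
    (hr : r.Prime) (hr1 : n < 2 * r) (hr2 : r ≤ n - 3)
    (hc1 : ∃ σ : Equiv.Perm U, σ ∈ G ∧ σ.IsCycle ∧ σ.support.card = r)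
    (hc2 : ∃ σ : Equiv.Perm U, σ ∈ G ∧ σ.IsCycle ∧ σ.support.card = n)
    (hc3 : ∃ σ : Equiv.Perm U, σ ∈ G ∧ σ.IsCycle ∧ σ.support.card = n - 1) :
    G = ⊤ := by
  subst hU
  have hprim := aux_prim G hn hc2 hc3
  obtain ⟨σ, hσ, hσc, hσs⟩ := hc1
  have hA := aux_jordan G hprim r hr (by omega) σ hσ hσc hσs
  have hodd : ∃ ρ ∈ G, Equiv.Perm.sign ρ = -1 := by
    obtain ⟨ρ, hρ, hρc, hρs⟩ := hc2
    obtain ⟨ρ', hρ', hρc', hρs'⟩ := hc3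
    rcases Nat.even_or_odd (Fintype.card U) with h | h
    · exact ⟨ρ, hρ, by rw [hρc.sign, hρs, h.neg_one_pow]⟩
    · refine ⟨ρ', hρ', ?_⟩
      have h' : Even (Fintype.card U - 1) := by
        obtain ⟨m, hm⟩ := h
        exact ⟨m, by omega⟩
      rw [hρc'.sign, hρs', h'.neg_one_pow]
  obtain ⟨ρ, hρ, hs⟩ := hodd
  rw [eq_top_iff]
  intro τ _
  rcases Int.units_eq_one_or (Equiv.Perm.sign τ) with h | h
  · exact hA (Equiv.Perm.mem_alternatingGroup.2 h)
  · have : τ * ρ ∈ G := hA (Equiv.Perm.mem_alternatingGroup.2 (by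
      rw [Equiv.Perm.sign_mul, h, hs]; rfl))
    simpa using G.mul_mem this (G.inv_mem hρ)
end
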